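/- Suppose δ is a Woodin cardinal and there are unboundedly many <δ-supercompact cardinals below δ. Then δ is Woodin for strong compactness. -/

import Mathlib

/-!
A framework for formalizing large-cardinal notions from
"Woodin for strong compactness cardinals" over the Mathlib model `ZFSet`
of ZFC.  The ambient set-theoretic universe `V` is the type `ZFSet`;
classes are sets `Set ZFSet`; everything is relativised to a "universe
class" `W : Set ZFSet` (the ambient universe being `W = Set.univ`), so
that the same definitions can also be interpreted inside transitive set
models of ZFC (used to express the forcing/consistency results).
-/

namespace WSC

/-! ### First-order formulas in the language of set theory -/

/-- First-order formulas in the language `{∈}`, with `n` free (de Bruijn) variables. -/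
inductive Fml : ℕ → Type where
  | mem {n} : Fin n → Fin n → Fml n
  | eq  {n} : Fin n → Fin n → Fml n
  | not {n} : Fml n → Fml n
  | and {n} : Fml n → Fml n → Fml n
  | ex  {n} : Fml (n + 1) → Fml n

namespace Fml

/-- Realization of a formula over the class `C`, with all quantifiers relativised to `C`. -/
def Realize (C : Set ZFSet) : ∀ {n}, Fml n → (Fin n → ZFSet) → Prop
  | _, .mem i j, v => v i ∈ v j
  | _, .eq i j, v => v i = v j
  | _, .not φ, v => ¬ Realize C φ v
  | _, .and φ ψ, v => Realize C φ v ∧ Realize C ψ v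
  | _, .ex φ, v => ∃ x ∈ C, Realize C φ (Fin.snoc v x)

def or {n} (φ ψ : Fml n) : Fml n := .not (.and (.not φ) (.not ψ))
def imp {n} (φ ψ : Fml n) : Fml n := Fml.or (.not φ) ψ
def iff {n} (φ ψ : Fml n) : Fml n := .and (imp φ ψ) (imp ψ φ)
def all {n} (φ : Fml (n + 1)) : Fml n := .not (.ex (.not φ))

/-- Universal closure. -/
def alls : ∀ {n}, Fml n → Fml 0
  | 0, φ => φ
  | _ + 1, φ => alls (all φ)

/-- Renaming of variables. -/
def rename : ∀ {n m}, (Fin n → Fin m) → Fml n → Fml m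
  | _, _, f, .mem i j => .mem (f i) (f j)
  | _, _, f, .eq i j => .eq (f i) (f j)
  | _, _, f, .not φ => .not (rename f φ)
  | _, _, f, .and φ ψ => .and (rename f φ) (rename f ψ)
  | _, _, f, .ex φ => .ex (rename (Fin.snoc (fun i => (f i).castSucc) (Fin.last _)) φ)

end Fml

/-- A sentence `φ` holds in the class `C`. -/
def Sat (C : Set ZFSet) (φ : Fml 0) : Prop := Fml.Realize C φ (fun i => i.elim0)

/-! ### The ZFC axioms -/

def extAx : Fml 0 :=
  Fml.all (Fml.all (Fml.imp (Fml.all (Fml.iff (.mem 2 0) (.mem 2 1))) (.eq 0 1)))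

def pairAx : Fml 0 := Fml.all (Fml.all (Fml.ex (Fml.and (.mem 0 2) (.mem 1 2))))

def unionAx : Fml 0 :=
  Fml.all (Fml.ex (Fml.all (Fml.all
    (Fml.imp (Fml.and (.mem 2 3) (.mem 3 0)) (.mem 2 1)))))

def powerAx : Fml 0 :=
  Fml.all (Fml.ex (Fml.all
    (Fml.imp (Fml.all (Fml.imp (.mem 3 2) (.mem 3 0))) (.mem 2 1))))

def infAx : Fml 0 :=
  Fml.ex (Fml.and
    (Fml.ex (Fml.and (.mem 1 0) (Fml.all (Fml.not (.mem 2 1)))))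
    (Fml.all (Fml.imp (.mem 1 0)
      (Fml.ex (Fml.and (.mem 2 0)
        (Fml.all (Fml.iff (.mem 3 2) (Fml.or (.mem 3 1) (.eq 3 1)))))))))

def foundAx : Fml 0 :=
  Fml.all (Fml.imp (Fml.ex (.mem 1 0))
    (Fml.ex (Fml.and (.mem 1 0) (Fml.all (Fml.imp (.mem 2 1) (Fml.not (.mem 2 0)))))))

def choiceAx : Fml 0 :=
  Fml.all (Fml.imp
    (Fml.and
      (Fml.all (Fml.imp (.mem 1 0) (Fml.ex (.mem 2 1))))
      (Fml.all (Fml.all (Fml.imp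
        (Fml.and (.mem 1 0) (Fml.and (.mem 2 0) (Fml.ex (Fml.and (.mem 3 1) (.mem 3 2)))))
        (.eq 1 2)))))
    (Fml.ex (Fml.all (Fml.imp (.mem 2 0)
      (Fml.ex (Fml.and (Fml.and (.mem 3 2) (.mem 3 1))
        (Fml.all (Fml.imp (Fml.and (.mem 4 2) (.mem 4 1)) (.eq 4 3)))))))))

/-- An instance of the separation schema, for a formula `φ` with parameters
`0, …, n-1` and distinguished variable `n`. -/
def sepAx (n : ℕ) (φ : Fml (n + 1)) : Fml 0 :=
  Fml.alls ((Fml.ex (Fml.all (Fml.iff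
    (Fml.mem (⟨n + 2, by omega⟩ : Fin (n + 3)) ⟨n + 1, by omega⟩)
    (Fml.and (Fml.mem (⟨n + 2, by omega⟩ : Fin (n + 3)) ⟨n, by omega⟩)
      (Fml.rename (fun i => if h : (i : ℕ) < n then (⟨i, by omega⟩ : Fin (n + 3))
        else ⟨n + 2, by omega⟩) φ))))) : Fml (n + 1))

/-- An instance of the collection schema, for a formula `φ` with parameters
`0, …, n-1` and distinguished variables `n` (input) and `n+1` (output). -/
def collAx (n : ℕ) (φ : Fml (n + 2)) : Fml 0 :=
  let φ' : Fml (n + 4) := Fml.rename (fun i => if h : (i : ℕ) < n then (⟨i, by omega⟩ : Fin (n + 4))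
    else ⟨(i : ℕ) + 2, by have := i.isLt; omega⟩) φ
  Fml.alls ((Fml.ex (Fml.all
    (Fml.imp (Fml.mem (⟨n + 2, by omega⟩ : Fin (n + 3)) ⟨n, by omega⟩)
      (Fml.imp (Fml.ex φ')
        (Fml.ex (Fml.and (Fml.mem (⟨n + 3, by omega⟩ : Fin (n + 4)) ⟨n + 1, by omega⟩) φ')))))) : Fml (n + 1))

/-- The ZFC axioms. -/
def ZFCax : Set (Fml 0) :=
  {extAx, pairAx, unionAx, powerAx, infAx, foundAx, choiceAx} ∪
    (⋃ n, Set.range (sepAx n)) ∪ (⋃ n, Set.range (collAx n))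

/-- A transitive set model of ZFC. -/
def IsZFModel (m : ZFSet) : Prop := m.IsTransitive ∧ ∀ φ ∈ ZFCax, Sat m.toSet φ

/-- A countable transitive model of ZFC. -/
def IsCtm (m : ZFSet) : Prop := IsZFModel m ∧ m.toSet.Countable

/-! ### Basic set-theoretic notions -/

/-- `x` is a (von Neumann) ordinal: a transitive set of transitive sets. -/
def IsOrd (x : ZFSet) : Prop := x.IsTransitive ∧ ∀ y ∈ x, ZFSet.IsTransitive y

/-- `x ≤ y` for ordinals. -/
def oLe (x y : ZFSet) : Prop := x ∈ y ∨ x = y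

/-- `f` is a function with domain `d` (coded as a set of Kuratowski pairs). -/
def IsFuncOn (d f : ZFSet) : Prop :=
  (∀ p ∈ f, ∃ a b : ZFSet, a ∈ d ∧ p = a.pair b) ∧ ∀ a ∈ d, ∃! b : ZFSet, a.pair b ∈ f

/-- All values of the (partial) function `f` lie in `b`. -/
def MapsInto (f b : ZFSet) : Prop := ∀ x y : ZFSet, x.pair y ∈ f → y ∈ b

/-- The function `f` is injective. -/
def InjFun (f : ZFSet) : Prop := ∀ x x' y : ZFSet, x.pair y ∈ f → x'.pair y ∈ f → x = x'

/-- `|a| ≤ |b|`, witnessed by an injection belonging to the universe class `W`. -/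
def SetLeIn (W : Set ZFSet) (a b : ZFSet) : Prop :=
  ∃ f ∈ W, IsFuncOn a f ∧ MapsInto f b ∧ InjFun f

/-- `κ` is a cardinal (relative to the universe class `W`). -/
def IsCardIn (W : Set ZFSet) (κ : ZFSet) : Prop :=
  IsOrd κ ∧ ∀ α ∈ κ, ¬ SetLeIn W κ α

/-- `M` is a transitive class. -/
def TransClass (M : Set ZFSet) : Prop := ∀ x ∈ M, ∀ y : ZFSet, y ∈ x → y ∈ M

/-- An elementary embedding `j : (W, ∈) → (M, ∈)` between two classes. -/
structure ElemEmb (W M : Set ZFSet) where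
  toFun : ZFSet → ZFSet
  maps : ∀ x ∈ W, toFun x ∈ M
  elem : ∀ {n : ℕ} (φ : Fml n) (v : Fin n → ZFSet), (∀ i, v i ∈ W) →
    (Fml.Realize W φ v ↔ Fml.Realize M φ (fun i => toFun (v i)))

/-- `κ` is the critical point of `j`: the least ordinal moved. -/
def IsCrit {W M : Set ZFSet} (j : ElemEmb W M) (κ : ZFSet) : Prop :=
  IsOrd κ ∧ j.toFun κ ≠ κ ∧ ∀ α ∈ κ, j.toFun α = α

/-! ### The rank hierarchy -/

/-- `x ∈ V_lam`. -/
def VMem (lam x : ZFSet) : Prop := x.rank < lam.rank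

/-- `V_lam ⊆ M` (with `V_lam` computed in the universe class `W`). -/
def VInclIn (W M : Set ZFSet) (lam : ZFSet) : Prop := ∀ x ∈ W, VMem lam x → x ∈ M

/-- `A ⊆ V_δ`. -/
def SubV (A δ : ZFSet) : Prop := ∀ x ∈ A, VMem δ x

/-- `A ∩ V_lam = B ∩ V_lam`. -/
def AgreeBelowIn (W : Set ZFSet) (lam A B : ZFSet) : Prop :=
  ∀ x ∈ W, VMem lam x → (x ∈ A ↔ x ∈ B)

/-- `A ∩ lam = B ∩ lam` (for sets of ordinals). -/
def AgreeMem (lam A B : ZFSet) : Prop := ∀ ξ ∈ lam, (ξ ∈ A ↔ ξ ∈ B)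

/-! ### Covering properties -/

/-- `M ⊨ |s| < t`: in `M` there is an injection of `s` into some ordinal `β ∈ t`. -/
def CardLtIn (M : Set ZFSet) (s t : ZFSet) : Prop :=
  ∃ β f : ZFSet, β ∈ t ∧ f ∈ M ∧ IsFuncOn s f ∧ MapsInto f β ∧ InjFun f

/-- `j` satisfies the weak `lam`-covering property (with target class `M`):
there is `s ∈ M` with `j '' lam ⊆ s` and `M ⊨ |s| < j κ`. -/
def WCovers (M : Set ZFSet) (j : ZFSet → ZFSet) (κ lam : ZFSet) : Prop :=
  ∃ s ∈ M, (∀ α ∈ lam, j α ∈ s) ∧ CardLtIn M s (j κ)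

/-- `j` satisfies the (full) `lam`-covering property: every `X ∈ W` with
`X ⊆ M` and `|X| ≤ lam` is covered by some `s ∈ M` with `M ⊨ |s| < j κ`. -/
def CoversIn (W M : Set ZFSet) (j : ZFSet → ZFSet) (κ lam : ZFSet) : Prop :=
  ∀ X ∈ W, X.toSet ⊆ M → SetLeIn W X lam → ∃ s ∈ M, X ⊆ s ∧ CardLtIn M s (j κ)

/-! ### Strongness -/

/-- `κ` is `lam`-strong. -/
def LamStrongIn (W : Set ZFSet) (κ lam : ZFSet) : Prop :=
  ∃ M : Set ZFSet, M ⊆ W ∧ TransClass M ∧ ∃ j : ElemEmb W M,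
    IsCrit j κ ∧ lam ∈ j.toFun κ ∧ VInclIn W M lam

/-- `κ` is `lam`-strong for `A`. -/
def LamStrongForIn (W : Set ZFSet) (κ lam A : ZFSet) : Prop :=
  ∃ M : Set ZFSet, M ⊆ W ∧ TransClass M ∧ ∃ j : ElemEmb W M,
    IsCrit j κ ∧ lam ∈ j.toFun κ ∧ VInclIn W M lam ∧ AgreeBelowIn W lam A (j.toFun A)

/-- `κ` is `<δ`-strong. -/
def LtStrongIn (W : Set ZFSet) (κ δ : ZFSet) : Prop :=
  ∀ lam : ZFSet, oLe κ lam → lam ∈ δ → LamStrongIn W κ lam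

/-- `κ` is `<δ`-strong for `A`. -/
def LtStrongForIn (W : Set ZFSet) (κ δ A : ZFSet) : Prop :=
  ∀ lam : ZFSet, oLe κ lam → lam ∈ δ → LamStrongForIn W κ lam A

/-! ### Strong compactness -/

/-- `κ` is `lam`-strongly compact (there is an embedding with critical point `κ`,
`j κ > lam`, satisfying the weak `lam`-covering property). -/
def LamSCIn (W : Set ZFSet) (κ lam : ZFSet) : Prop :=
  ∃ M : Set ZFSet, M ⊆ W ∧ TransClass M ∧ ∃ j : ElemEmb W M,
    IsCrit j κ ∧ lam ∈ j.toFun κ ∧ WCovers M j.toFun κ lam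

/-- `κ` is `lam`-strongly compact for the set of ordinals `A`: there is a
`lam`-strong compactness embedding `j` (one with the full `lam`-covering
property) with critical point `κ` and `A ∩ lam = j A ∩ lam`. -/
def LamSCForIn (W : Set ZFSet) (κ lam A : ZFSet) : Prop :=
  ∃ M : Set ZFSet, M ⊆ W ∧ TransClass M ∧ ∃ j : ElemEmb W M,
    IsCrit j κ ∧ lam ∈ j.toFun κ ∧ CoversIn W M j.toFun κ lam ∧ AgreeMem lam A (j.toFun A)

/-- `κ` is `<δ`-strongly compact. -/
def LtSCIn (W : Set ZFSet) (κ δ : ZFSet) : Prop :=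
  ∀ lam : ZFSet, oLe κ lam → lam ∈ δ → LamSCIn W κ lam

/-- `κ` is `<δ`-strongly compact for `A`. -/
def LtSCForIn (W : Set ZFSet) (κ δ A : ZFSet) : Prop :=
  ∀ lam : ZFSet, oLe κ lam → lam ∈ δ → LamSCForIn W κ lam A

/-! ### Supercompactness -/

/-- `M` is closed under `lam`-sequences (from the universe class `W`). -/
def SeqClosedIn (W M : Set ZFSet) (lam : ZFSet) : Prop :=
  ∀ f ∈ W, IsFuncOn lam f → (∀ x y : ZFSet, x.pair y ∈ f → y ∈ M) → f ∈ M

/-- `κ` is `lam`-supercompact. -/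
def LamSupercompactIn (W : Set ZFSet) (κ lam : ZFSet) : Prop :=
  ∃ M : Set ZFSet, M ⊆ W ∧ TransClass M ∧ ∃ j : ElemEmb W M,
    IsCrit j κ ∧ lam ∈ j.toFun κ ∧ SeqClosedIn W M lam

/-- `κ` is `lam`-supercompact for `A`. -/
def LamSupercompactForIn (W : Set ZFSet) (κ lam A : ZFSet) : Prop :=
  ∃ M : Set ZFSet, M ⊆ W ∧ TransClass M ∧ ∃ j : ElemEmb W M,
    IsCrit j κ ∧ lam ∈ j.toFun κ ∧ SeqClosedIn W M lam ∧ AgreeBelowIn W lam A (j.toFun A)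

/-- `κ` is `<δ`-supercompact. -/
def LtSupercompactIn (W : Set ZFSet) (κ δ : ZFSet) : Prop :=
  ∀ lam : ZFSet, oLe κ lam → lam ∈ δ → LamSupercompactIn W κ lam

/-- `κ` is `<δ`-supercompact for `A`. -/
def LtSupercompactForIn (W : Set ZFSet) (κ δ A : ZFSet) : Prop :=
  ∀ lam : ZFSet, oLe κ lam → lam ∈ δ → LamSupercompactForIn W κ lam A

/-! ### The global large-cardinal notions -/

/-- `δ` is a Woodin cardinal. -/
def WoodinIn (W : Set ZFSet) (δ : ZFSet) : Prop :=
  IsCardIn W δ ∧ ∀ A ∈ W, SubV A δ → ∃ κ, κ ∈ δ ∧ LtStrongForIn W κ δ A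

/-- `δ` is a Woodin for strong compactness cardinal. -/
def WoodinSCIn (W : Set ZFSet) (δ : ZFSet) : Prop :=
  IsCardIn W δ ∧ ∀ A ∈ W, A ⊆ δ → ∃ κ, κ ∈ δ ∧ LtSCForIn W κ δ A

/-- `δ` is a Vopěnka cardinal. -/
def VopenkaIn (W : Set ZFSet) (δ : ZFSet) : Prop :=
  IsCardIn W δ ∧ ∀ A ∈ W, SubV A δ → ∃ κ, κ ∈ δ ∧ LtSupercompactForIn W κ δ A

/-- `δ` is Woodin and a limit of `<δ`-supercompact cardinals. -/
def WoodinLimSupercompactIn (W : Set ZFSet) (δ : ZFSet) : Prop :=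
  WoodinIn W δ ∧ ∀ α ∈ δ, ∃ κ : ZFSet, α ∈ κ ∧ κ ∈ δ ∧ LtSupercompactIn W κ δ

/-! ### Inaccessibility -/

/-- `δ` is a regular ordinal: the range of any function from a smaller
ordinal into `δ` is bounded. -/
def RegularIn (W : Set ZFSet) (δ : ZFSet) : Prop :=
  IsOrd δ ∧ ∀ α ∈ δ, ∀ f ∈ W, IsFuncOn α f → MapsInto f δ →
    ∃ β ∈ δ, ∀ x y : ZFSet, x.pair y ∈ f → y ∈ β

/-- The power set of `x` relative to `W`. -/
def powersetIn (W : Set ZFSet) (x : ZFSet) : ZFSet := ZFSet.sep (fun z => z ∈ W) x.powerset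

/-- `δ` is a strong limit cardinal. -/
def StrongLimitIn (W : Set ZFSet) (δ : ZFSet) : Prop :=
  IsCardIn W δ ∧ ∀ α ∈ δ, ∃ β ∈ δ, SetLeIn W (powersetIn W α) β

/-- `δ` is inaccessible: an uncountable regular strong limit cardinal. -/
def InaccessibleIn (W : Set ZFSet) (δ : ZFSet) : Prop :=
  ZFSet.omega ∈ δ ∧ IsCardIn W δ ∧ RegularIn W δ ∧ StrongLimitIn W δ

/-! ### Ultrafilters and measurability -/

/-- Relative complement `a \ b`. -/
def zdiff (a b : ZFSet) : ZFSet := ZFSet.sep (fun x => x ∉ b) a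

/-- Intersection `a ∩ b`. -/
def zinter (a b : ZFSet) : ZFSet := ZFSet.sep (fun x => x ∈ b) a

/-- `U` is a nonprincipal `α`-complete ultrafilter on `α`. -/
def IsUfOnIn (W : Set ZFSet) (α U : ZFSet) : Prop :=
  (∀ x ∈ U, x ⊆ α) ∧ α ∈ U ∧ (∅ : ZFSet) ∉ U ∧
  (∀ x ∈ U, ∀ y : ZFSet, y ∈ W → y ⊆ α → x ⊆ y → y ∈ U) ∧
  (∀ x ∈ W, x ⊆ α → (x ∈ U ∨ zdiff α x ∈ U)) ∧
  (∀ β ∈ α, ∀ g ∈ W, IsFuncOn β g → MapsInto g U →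
    ZFSet.sep (fun ξ => ∀ p q : ZFSet, p.pair q ∈ g → ξ ∈ q) α ∈ U) ∧
  (∀ ξ ∈ α, ZFSet.sep (fun x => x = ξ) α ∉ U)

/-- `U` is a normal ultrafilter on `α`: a nonprincipal `α`-complete
ultrafilter closed under diagonal intersections. -/
def IsNormalUfOnIn (W : Set ZFSet) (α U : ZFSet) : Prop :=
  IsUfOnIn W α U ∧
    ∀ g ∈ W, IsFuncOn α g → MapsInto g U →
      ZFSet.sep (fun ξ => ∀ p q : ZFSet, p.pair q ∈ g → p ∈ ξ → ξ ∈ q) α ∈ U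

/-- `α` is a measurable cardinal. -/
def MeasurableIn (W : Set ZFSet) (α : ZFSet) : Prop := ∃ U ∈ W, IsUfOnIn W α U

/-! ### Functions `f : δ → δ` and closure points -/

/-- `f` codes a function from `δ` to `δ`. -/
def FuncSelf (δ f : ZFSet) : Prop := IsFuncOn δ f ∧ MapsInto f δ

/-- `κ` is a closure point of `f`, i.e. `f '' κ ⊆ κ`. -/
def ClosurePt (f κ : ZFSet) : Prop := ∀ x y : ZFSet, x.pair y ∈ f → x ∈ κ → y ∈ κ

/-! ### GCH -/

/-- GCH: for every infinite cardinal `κ`, any family of subsets of `κ` has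
size at most `κ` or size at least that of the full power set of `κ`. -/
def GCHIn (W : Set ZFSet) : Prop :=
  ∀ κ ∈ W, IsCardIn W κ → oLe ZFSet.omega κ →
    ∀ X ∈ W, (∀ z ∈ X, z ⊆ κ) → (SetLeIn W X κ ∨ SetLeIn W (powersetIn W κ) X)

/-! ### Forcing -/

/-- `(P, R)` is a forcing notion (a preordered set, `x.pair y ∈ R` meaning
`x ≤ y`, i.e. `x` is stronger than `y`). -/
def IsPoset (P R : ZFSet) : Prop :=
  (∀ p ∈ P, p.pair p ∈ R) ∧
  (∀ p q r : ZFSet, p.pair q ∈ R → q.pair r ∈ R → p.pair r ∈ R) ∧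
  (∀ x y : ZFSet, x.pair y ∈ R → x ∈ P ∧ y ∈ P)

/-- `G` is an `m`-generic filter on the forcing notion `(P, R) ∈ m`. -/
def IsGenericFilter (m P R G : ZFSet) : Prop :=
  G ⊆ P ∧
  (∀ p ∈ G, ∀ q ∈ P, p.pair q ∈ R → q ∈ G) ∧
  (∀ p ∈ G, ∀ q ∈ G, ∃ r ∈ G, r.pair p ∈ R ∧ r.pair q ∈ R) ∧
  (∀ D ∈ m, (D ⊆ P ∧ ∀ p ∈ P, ∃ q ∈ D, q.pair p ∈ R) → ∃ q, q ∈ G ∧ q ∈ D)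

/-- `n = m[G]` : `n` is a transitive ZFC-model extending `m` and containing
`G`, and is the least such. -/
def IsGenericExt (m G n : ZFSet) : Prop :=
  IsZFModel n ∧ m ⊆ n ∧ G ∈ n ∧
    ∀ n' : ZFSet, IsZFModel n' → m ⊆ n' → G ∈ n' → n ⊆ n'

/-- `n` is a (set-)forcing extension of the transitive model `m`. -/
def IsForcingExt (m n : ZFSet) : Prop :=
  ∃ P R G : ZFSet, P ∈ m ∧ R ∈ m ∧ IsPoset P R ∧
    IsGenericFilter m P R G ∧ IsGenericExt m G n

/-! ### Ambient (full-universe) abbreviations -/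

abbrev LamStrong (κ lam : ZFSet) : Prop := LamStrongIn Set.univ κ lam
abbrev LamStrongFor (κ lam A : ZFSet) : Prop := LamStrongForIn Set.univ κ lam A
abbrev LtStrong (κ δ : ZFSet) : Prop := LtStrongIn Set.univ κ δ
abbrev LtStrongFor (κ δ A : ZFSet) : Prop := LtStrongForIn Set.univ κ δ A
abbrev LamSC (κ lam : ZFSet) : Prop := LamSCIn Set.univ κ lam
abbrev LamSCFor (κ lam A : ZFSet) : Prop := LamSCForIn Set.univ κ lam A
abbrev LtSC (κ δ : ZFSet) : Prop := LtSCIn Set.univ κ δ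
abbrev LtSCFor (κ δ A : ZFSet) : Prop := LtSCForIn Set.univ κ δ A
abbrev LamSupercompact (κ lam : ZFSet) : Prop := LamSupercompactIn Set.univ κ lam
abbrev LtSupercompact (κ δ : ZFSet) : Prop := LtSupercompactIn Set.univ κ δ
abbrev Woodin (δ : ZFSet) : Prop := WoodinIn Set.univ δ
abbrev WoodinSC (δ : ZFSet) : Prop := WoodinSCIn Set.univ δ
abbrev Vopenka (δ : ZFSet) : Prop := VopenkaIn Set.univ δ
abbrev IsCard (κ : ZFSet) : Prop := IsCardIn Set.univ κ
abbrev Inaccessible (δ : ZFSet) : Prop := InaccessibleIn Set.univ δ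
abbrev Covers (M : Set ZFSet) (j : ZFSet → ZFSet) (κ lam : ZFSet) : Prop :=
  CoversIn Set.univ M j κ lam
abbrev VIncl (M : Set ZFSet) (lam : ZFSet) : Prop := VInclIn Set.univ M lam
abbrev AgreeBelow (lam A B : ZFSet) : Prop := AgreeBelowIn Set.univ lam A B
abbrev SeqClosed (M : Set ZFSet) (lam : ZFSet) : Prop := SeqClosedIn Set.univ M lam

universe u
/-! ### Definability combinators -/

theorem realize_rename (C : Set ZFSet.{u}) {n : ℕ} (φ : Fml n) :
    ∀ {m : ℕ} (f : Fin n → Fin m) (v : Fin m → ZFSet.{u}),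
      Fml.Realize C (Fml.rename f φ) v ↔ Fml.Realize C φ (fun i => v (f i)) := by
  induction φ with
  | mem i j => intro m f v; simp [Fml.rename, Fml.Realize]
  | eq i j => intro m f v; simp [Fml.rename, Fml.Realize]
  | not φ ih => intro m f v; simp [Fml.rename, Fml.Realize, ih]
  | and φ ψ ih1 ih2 => intro m f v; simp [Fml.rename, Fml.Realize, ih1, ih2]
  | ex φ ih =>
    intro m f v
    simp only [Fml.rename, Fml.Realize, ih]
    refine exists_congr fun x => and_congr_right fun _ => ?_
    have : (fun i => (Fin.snoc v x : Fin (m+1) → ZFSet.{u})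
        ((Fin.snoc (fun i => (f i).castSucc) (Fin.last m) : Fin (_+1) → Fin (m+1)) i))
        = (Fin.snoc (fun i => v (f i)) x : Fin (_+1) → ZFSet.{u}) := by
      funext i
      refine Fin.lastCases ?_ (fun i => ?_) i <;> simp
    rw [this]

/-- Value of the (total) application of the relation `F` at `x`. -/
noncomputable def app (F x : ZFSet.{u}) : ZFSet.{u} :=
  ZFSet.sep (fun z => x.pair z ∈ F) (ZFSet.sUnion (ZFSet.sUnion F))

theorem mem_app {F x z : ZFSet.{u}} : z ∈ app F x ↔ x.pair z ∈ F := by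
  unfold app
  rw [ZFSet.mem_sep]
  refine ⟨fun h => h.2, fun h => ⟨?_, h⟩⟩
  rw [ZFSet.mem_sUnion]
  refine ⟨{x, z}, ?_, by simp⟩
  rw [ZFSet.mem_sUnion]
  exact ⟨_, h, by simp [ZFSet.pair]⟩

class TrN (N : Set ZFSet.{u} → Prop) : Prop where
  tr : ∀ C, N C → TransClass C
class PrN (N : Set ZFSet.{u} → Prop) : Prop extends TrN N where
  pr : ∀ C, N C → ∀ x ∈ C, ∀ y ∈ C, ZFSet.pair x y ∈ C

/-- Transitive, closed under pairing. -/
def TP (C : Set ZFSet.{u}) : Prop := TransClass C ∧ ∀ x ∈ C, ∀ y ∈ C, ZFSet.pair x y ∈ C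
def Nice (C : Set ZFSet.{u}) : Prop := TP C ∧ ∀ x ∈ C, ∀ y ∈ C, app x y ∈ C

instance : TrN (TransClass : Set ZFSet.{u} → Prop) := ⟨fun _ h => h⟩
instance : PrN (TP : Set ZFSet.{u} → Prop) := { tr := fun _ h => h.1, pr := fun _ h => h.2 }
instance : PrN (Nice : Set ZFSet.{u} → Prop) := { tr := fun _ h => h.1.1, pr := fun _ h => h.1.2 }

/-- Definability of a relation, uniformly in all classes satisfying `N`. -/
def Dfb (N : Set ZFSet.{u} → Prop) {n : ℕ} (P : Set ZFSet.{u} → (Fin n → ZFSet.{u}) → Prop) : Prop :=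
  ∃ φ : Fml n, ∀ C, N C → ∀ v, (∀ i, v i ∈ C) → (Fml.Realize C φ v ↔ P C v)

def Tm (N : Set ZFSet.{u} → Prop) {n : ℕ} (t : (Fin n → ZFSet.{u}) → ZFSet.{u}) : Prop :=
  (∀ C, N C → ∀ v, (∀ i, v i ∈ C) → t v ∈ C) ∧
    Dfb N (fun (_ : Set ZFSet.{u}) (w : Fin (n+1) → ZFSet.{u}) => w (Fin.last n) = t (Fin.init w))

section
variable {N : Set ZFSet.{u} → Prop} {n : ℕ}

theorem Dfb.congr {P Q : Set ZFSet.{u} → (Fin n → ZFSet.{u}) → Prop} (h : Dfb N P)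
    (hPQ : ∀ C, N C → ∀ v, (∀ i, v i ∈ C) → (P C v ↔ Q C v)) : Dfb N Q := by
  obtain ⟨φ, hφ⟩ := h
  exact ⟨φ, fun C hC v hv => (hφ C hC v hv).trans (hPQ C hC v hv)⟩

theorem Dfb.not {P : Set ZFSet.{u} → (Fin n → ZFSet.{u}) → Prop} (h : Dfb N P) :
    Dfb N (fun C v => ¬ P C v) := by
  obtain ⟨φ, hφ⟩ := h
  exact ⟨.not φ, fun C hC v hv => not_congr (hφ C hC v hv)⟩

theorem Dfb.and {P Q : Set ZFSet.{u} → (Fin n → ZFSet.{u}) → Prop} (h : Dfb N P) (h' : Dfb N Q) :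
    Dfb N (fun C v => P C v ∧ Q C v) := by
  obtain ⟨φ, hφ⟩ := h
  obtain ⟨ψ, hψ⟩ := h'
  exact ⟨.and φ ψ, fun C hC v hv => and_congr (hφ C hC v hv) (hψ C hC v hv)⟩

theorem Dfb.or {P Q : Set ZFSet.{u} → (Fin n → ZFSet.{u}) → Prop} (h : Dfb N P) (h' : Dfb N Q) :
    Dfb N (fun C v => P C v ∨ Q C v) :=
  ((h.not.and h'.not).not).congr fun _ _ _ _ => by tauto

theorem Dfb.imp {P Q : Set ZFSet.{u} → (Fin n → ZFSet.{u}) → Prop} (h : Dfb N P) (h' : Dfb N Q) :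
    Dfb N (fun C v => P C v → Q C v) :=
  ((h.and h'.not).not).congr fun _ _ _ _ => by tauto

theorem Dfb.iff {P Q : Set ZFSet.{u} → (Fin n → ZFSet.{u}) → Prop} (h : Dfb N P) (h' : Dfb N Q) :
    Dfb N (fun C v => (P C v ↔ Q C v)) :=
  ((h.imp h').and (h'.imp h)).congr fun _ _ _ _ => by tauto

theorem Dfb.exC {P : Set ZFSet.{u} → (Fin n → ZFSet.{u}) → ZFSet.{u} → Prop}
    (h : Dfb N (fun C (w : Fin (n+1) → ZFSet.{u}) => P C (Fin.init w) (w (Fin.last n)))) :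
    Dfb N (fun C v => ∃ x ∈ C, P C v x) := by
  obtain ⟨φ, hφ⟩ := h
  refine ⟨.ex φ, fun C hC v hv => ?_⟩
  show (∃ x ∈ C, _) ↔ _
  refine exists_congr fun x => and_congr_right fun hx => ?_
  rw [hφ C hC (Fin.snoc v x)]
  · simp
  · intro i
    refine Fin.lastCases ?_ (fun i => ?_) i <;> simp [hx, hv]

theorem Dfb.allC {P : Set ZFSet.{u} → (Fin n → ZFSet.{u}) → ZFSet.{u} → Prop}
    (h : Dfb N (fun C (w : Fin (n+1) → ZFSet.{u}) => P C (Fin.init w) (w (Fin.last n)))) :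
    Dfb N (fun C v => ∀ x ∈ C, P C v x) :=
  (Dfb.exC (P := fun C v x => ¬ P C v x) h.not).not.congr fun _ _ _ _ => by push Not; rfl

theorem Dfb.ren {m : ℕ} {P : Set ZFSet.{u} → (Fin n → ZFSet.{u}) → Prop} (h : Dfb N P)
    (f : Fin n → Fin m) : Dfb N (fun C v => P C (fun i => v (f i))) := by
  obtain ⟨φ, hφ⟩ := h
  exact ⟨φ.rename f, fun C hC v hv => (realize_rename C φ f v).trans (hφ C hC _ fun i => hv _)⟩

theorem Dfb.memV (i j : Fin n) : Dfb N (fun _ v => v i ∈ v j) :=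
  ⟨.mem i j, fun _ _ _ _ => Iff.rfl⟩
theorem Dfb.eqV (i j : Fin n) : Dfb N (fun _ v => v i = v j) :=
  ⟨.eq i j, fun _ _ _ _ => Iff.rfl⟩

theorem Dfb.subst {P : Set ZFSet.{u} → (Fin n → ZFSet.{u}) → ZFSet.{u} → Prop}
    {t : (Fin n → ZFSet.{u}) → ZFSet.{u}} (ht : Tm N t)
    (h : Dfb N (fun C (w : Fin (n+1) → ZFSet.{u}) => P C (Fin.init w) (w (Fin.last n)))) :
    Dfb N (fun C v => P C v (t v)) := by
  refine (Dfb.exC (P := fun C v x => x = t v ∧ P C v x) (ht.2.and h)).congr fun C hC v hv => ?_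
  constructor
  · rintro ⟨x, -, rfl, h⟩; exact h
  · intro h; exact ⟨t v, ht.1 C hC v hv, rfl, h⟩

theorem Tm.var {t : (Fin n → ZFSet.{u}) → ZFSet.{u}} (h : ∃ i, ∀ w, t w = w i) : Tm N t := by
  obtain ⟨i, hi⟩ := h
  obtain rfl : t = fun w => w i := funext hi
  exact ⟨fun C _ v hv => hv i, Dfb.eqV (Fin.last n) i.castSucc⟩

theorem Tm.wk {t : (Fin n → ZFSet.{u}) → ZFSet.{u}} (h : Tm N t) :
    Tm N (fun w : Fin (n+1) → ZFSet.{u} => t (Fin.init w)) := by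
  refine ⟨fun C hC v hv => h.1 C hC _ fun i => hv _, ?_⟩
  refine (h.2.ren (m := n+2) (Fin.snoc (fun i => i.castSucc.castSucc) (Fin.last _))).congr
    fun C hC v hv => ?_
  simp only [Fin.snoc_last]
  refine Eq.congr_right (congrArg t ?_)
  funext i
  simp [Fin.init]

theorem Dfb.mem {s t : (Fin n → ZFSet.{u}) → ZFSet.{u}} (hs : Tm N s) (ht : Tm N t) :
    Dfb N (fun _ v => s v ∈ t v) :=
  Dfb.subst (P := fun _ v x => x ∈ t v) hs
    (Dfb.subst (P := fun _ w y => w (Fin.last n) ∈ y) ht.wk (Dfb.memV (Fin.last n).castSucc (Fin.last _)))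

theorem Dfb.eq {s t : (Fin n → ZFSet.{u}) → ZFSet.{u}} (hs : Tm N s) (ht : Tm N t) :
    Dfb N (fun _ v => s v = t v) :=
  Dfb.subst (P := fun _ v x => x = t v) hs
    (Dfb.subst (P := fun _ w y => w (Fin.last n) = y) ht.wk (Dfb.eqV (Fin.last n).castSucc (Fin.last _)))

theorem Dfb.exB [TrN N] {t : (Fin n → ZFSet.{u}) → ZFSet.{u}} (ht : Tm N t)
    {P : Set ZFSet.{u} → (Fin n → ZFSet.{u}) → ZFSet.{u} → Prop}
    (h : Dfb N (fun C (w : Fin (n+1) → ZFSet.{u}) => P C (Fin.init w) (w (Fin.last n)))) :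
    Dfb N (fun C v => ∃ x ∈ t v, P C v x) := by
  refine (Dfb.exC (P := fun C v x => x ∈ t v ∧ P C v x)
    ((Dfb.mem (Tm.var ⟨Fin.last n, fun _ => rfl⟩) ht.wk).and h)).congr fun C hC v hv => ?_
  constructor
  · rintro ⟨x, -, h⟩; exact ⟨x, h⟩
  · rintro ⟨x, h⟩; exact ⟨x, TrN.tr C hC _ (ht.1 C hC v hv) _ h.1, h⟩

theorem Dfb.allB [TrN N] {t : (Fin n → ZFSet.{u}) → ZFSet.{u}} (ht : Tm N t)
    {P : Set ZFSet.{u} → (Fin n → ZFSet.{u}) → ZFSet.{u} → Prop}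
    (h : Dfb N (fun C (w : Fin (n+1) → ZFSet.{u}) => P C (Fin.init w) (w (Fin.last n)))) :
    Dfb N (fun C v => ∀ x ∈ t v, P C v x) :=
  (Dfb.exB ht (P := fun C v x => ¬ P C v x) h.not).not.congr fun _ _ _ _ => by push Not; rfl

end

theorem eq_upair_iff {p x y : ZFSet.{u}} :
    p = {x, y} ↔ (∀ z ∈ p, z = x ∨ z = y) ∧ x ∈ p ∧ y ∈ p := by
  constructor
  · rintro rfl; simp
  · rintro ⟨h1, h2, h3⟩
    ext z
    simp only [ZFSet.mem_pair]
    exact ⟨h1 z, by rintro (rfl | rfl) <;> assumption⟩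

theorem eq_pair_iff {p x y : ZFSet.{u}} :
    p = ZFSet.pair x y ↔ (∀ z ∈ p, ((∀ w ∈ z, w = x ∨ w = x) ∧ x ∈ z ∧ x ∈ z) ∨
      ((∀ w ∈ z, w = x ∨ w = y) ∧ x ∈ z ∧ y ∈ z)) ∧
      (∃ z ∈ p, (∀ w ∈ z, w = x ∨ w = x) ∧ x ∈ z ∧ x ∈ z) ∧
      (∃ z ∈ p, (∀ w ∈ z, w = x ∨ w = y) ∧ x ∈ z ∧ y ∈ z) := by
  simp only [← eq_upair_iff]
  have : ZFSet.pair x y = {{x, x}, {x, y}} := by simp [ZFSet.pair]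
  rw [this, eq_upair_iff]
  simp

theorem tm_pair_raw (N : Set ZFSet.{u} → Prop) [TrN N] {n : ℕ} (i j k : Fin n) :
    Dfb N (fun _ v => v i = ZFSet.pair (v j) (v k)) := by
  simp only [eq_pair_iff]
  repeat' first
    | apply Dfb.and | apply Dfb.or | apply Dfb.exB | apply Dfb.allB | apply Dfb.mem | apply Dfb.eq
    | exact Tm.var ⟨_, fun _ => rfl⟩

theorem Dfb.subst2 {N : Set ZFSet.{u} → Prop} {n : ℕ} {P : Set ZFSet.{u} → ZFSet.{u} → ZFSet.{u} → ZFSet.{u} → Prop}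
    {s t : (Fin n → ZFSet.{u}) → ZFSet.{u}} (hs : Tm N s) (ht : Tm N t)
    (h : Dfb N (n := n + 3) (fun C w => P C (w (Fin.last n).castSucc.castSucc)
      (w (Fin.last (n+1)).castSucc) (w (Fin.last (n+2))))) :
    Dfb N (fun C (w : Fin (n+1) → ZFSet.{u}) => P C (w (Fin.last n)) (s (Fin.init w)) (t (Fin.init w))) := by
  refine Dfb.subst (P := fun C w x => P C (w (Fin.last n)) x (t (Fin.init w))) hs.wk ?_
  refine Dfb.subst (P := fun C w y => P C (w (Fin.last n).castSucc) (w (Fin.last (n+1))) y) ht.wk.wk ?_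
  exact h

theorem Tm.pair {N : Set ZFSet.{u} → Prop} [PrN N] {n : ℕ}
    {s t : (Fin n → ZFSet.{u}) → ZFSet.{u}} (hs : Tm N s) (ht : Tm N t) :
    Tm N (fun v => ZFSet.pair (s v) (t v)) :=
  ⟨fun C hC v hv => PrN.pr C hC _ (hs.1 C hC v hv) _ (ht.1 C hC v hv),
    Dfb.subst2 (P := fun _ p x y => p = ZFSet.pair x y) hs ht (tm_pair_raw N _ _ _)⟩

theorem eq_app_iff {C : Set ZFSet.{u}} (hC : TP C) {F x y : ZFSet.{u}} (hF : F ∈ C) (hy : y ∈ C) :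
    y = app F x ↔ ∀ z ∈ C, (z ∈ y ↔ ZFSet.pair x z ∈ F) := by
  constructor
  · rintro rfl z _; exact mem_app
  · intro h
    ext z
    rw [mem_app]
    constructor
    · intro hz; exact (h z (hC.1 y hy z hz)).1 hz
    · intro hz
      refine (h z ?_).2 hz
      have h1 : ({x, z} : ZFSet.{u}) ∈ C := hC.1 _ (hC.1 F hF _ hz) _ (by simp [ZFSet.pair])
      exact hC.1 _ h1 _ (by simp)

theorem Tm.app {n : ℕ} {s t : (Fin n → ZFSet.{u}) → ZFSet.{u}} (hs : Tm Nice s) (ht : Tm Nice t) :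
    Tm Nice (fun v => app (s v) (t v)) := by
  refine ⟨fun C hC v hv => hC.2 _ (hs.1 C hC v hv) _ (ht.1 C hC v hv), ?_⟩
  refine Dfb.subst2 (P := fun _ p x y => p = WSC.app x y) hs ht ?_
  have h : Dfb (Nice : Set ZFSet.{u} → Prop) (fun C (v : Fin (n+3) → ZFSet.{u}) =>
      ∀ z ∈ C, (z ∈ v (Fin.last n).castSucc.castSucc ↔
        ZFSet.pair (v (Fin.last (n+2))) z ∈ v (Fin.last (n+1)).castSucc)) := by
    repeat' first
      | apply Dfb.allC | apply Dfb.iff | apply Dfb.mem | apply Tm.pair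
      | exact Tm.var ⟨_, fun _ => rfl⟩
  exact h.congr fun C hC v hv => (eq_app_iff hC.1 (hv _) (hv _)).symm

/-! ### Transfer along elementary embeddings of the universe -/

theorem Dfb.transfer {N : Set ZFSet.{u} → Prop} {M : Set ZFSet.{u}} (j : ElemEmb.{u,u} Set.univ M)
    (h1 : N Set.univ) (h2 : N M) {n : ℕ} {P : Set ZFSet.{u} → (Fin n → ZFSet.{u}) → Prop}
    (h : Dfb N P) (v : Fin n → ZFSet.{u}) : P Set.univ v ↔ P M (fun i => j.toFun (v i)) := by
  obtain ⟨φ, hφ⟩ := h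
  rw [← hφ _ h1 v fun _ => trivial, ← hφ _ h2 _ fun i => j.maps _ trivial]
  exact j.elem φ v fun _ => trivial

theorem nice_univ : Nice (Set.univ : Set ZFSet.{u}) :=
  ⟨⟨fun _ _ _ _ => trivial, fun _ _ _ _ => trivial⟩, fun _ _ _ _ => trivial⟩

theorem nice_of_emb {M : Set ZFSet.{u}} (hM : TransClass M) (j : ElemEmb.{u,u} Set.univ M) : Nice M := by
  have hp : TP M := by
    refine ⟨hM, fun x hx y hy => ?_⟩
    have h : Dfb (TransClass : Set ZFSet.{u} → Prop) (fun C (_ : Fin 0 → ZFSet.{u}) =>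
        ∀ x ∈ C, ∀ y ∈ C, ∃ p ∈ C, p = ZFSet.pair x y) := by
      apply Dfb.allC; apply Dfb.allC; apply Dfb.exC
      exact tm_pair_raw TransClass (Fin.last 2) (Fin.last 0).castSucc.castSucc (Fin.last 1).castSucc
    obtain ⟨p, hp, rfl⟩ := (h.transfer j nice_univ.1.1 hM Fin.elim0).1
      (fun x _ y _ => ⟨_, trivial, rfl⟩) x hx y hy
    exact hp
  refine ⟨hp, fun x hx y hy => ?_⟩
  have h : Dfb (TP : Set ZFSet.{u} → Prop) (fun C (_ : Fin 0 → ZFSet.{u}) =>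
      ∀ x ∈ C, ∀ y ∈ C, ∃ p ∈ C, ∀ z ∈ C, (z ∈ p ↔ ZFSet.pair y z ∈ x)) := by
    repeat' first
      | apply Dfb.allC | apply Dfb.exC | apply Dfb.iff | apply Dfb.mem | apply Tm.pair
      | exact Tm.var ⟨_, fun _ => rfl⟩
  obtain ⟨p, hp', h⟩ := (h.transfer j nice_univ.1 hp Fin.elim0).1
      (fun x _ y _ => ⟨app x y, trivial, fun z _ => mem_app⟩) x hx y hy
  rw [← eq_app_iff hp hx hp'] at h
  exact (h ▸ hp' : _)

/-- Bundled elementary embeddings of the universe into transitive classes. -/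
structure VEmb (M : Set ZFSet.{u}) extends ElemEmb.{u,u} Set.univ M where
  trM : TransClass M

namespace VEmb
variable {M : Set ZFSet.{u}} (j : VEmb M)

instance : CoeFun (VEmb M) (fun _ => ZFSet.{u} → ZFSet.{u}) := ⟨fun j => j.toFun⟩

theorem nice (j : VEmb M) : Nice M := nice_of_emb j.trM j.toElemEmb
theorem mem_M (x : ZFSet.{u}) : j x ∈ M := j.maps x trivial

theorem tr {n : ℕ} {P : Set ZFSet.{u} → (Fin n → ZFSet.{u}) → Prop}
    (h : Dfb Nice P) (v : Fin n → ZFSet.{u}) : P Set.univ v ↔ P M (fun i => j (v i)) :=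
  h.transfer j.toElemEmb nice_univ j.nice v

theorem tr1 (P : Set ZFSet.{u} → ZFSet.{u} → Prop)
    (h : Dfb Nice (n := 1) (fun C v => P C (v 0))) (a : ZFSet.{u}) :
    P Set.univ a ↔ P M (j a) :=
  j.tr h ![a]

theorem tr2 (P : Set ZFSet.{u} → ZFSet.{u} → ZFSet.{u} → Prop)
    (h : Dfb Nice (n := 2) (fun C v => P C (v 0) (v 1))) (a b : ZFSet.{u}) :
    P Set.univ a b ↔ P M (j a) (j b) :=
  j.tr h ![a, b]

theorem tr3 (P : Set ZFSet.{u} → ZFSet.{u} → ZFSet.{u} → ZFSet.{u} → Prop)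
    (h : Dfb Nice (n := 3) (fun C v => P C (v 0) (v 1) (v 2))) (a b c : ZFSet.{u}) :
    P Set.univ a b c ↔ P M (j a) (j b) (j c) :=
  j.tr h ![a, b, c]

theorem tr4 (P : Set ZFSet.{u} → ZFSet.{u} → ZFSet.{u} → ZFSet.{u} → ZFSet.{u} → Prop)
    (h : Dfb Nice (n := 4) (fun C v => P C (v 0) (v 1) (v 2) (v 3))) (a b c d : ZFSet.{u}) :
    P Set.univ a b c d ↔ P M (j a) (j b) (j c) (j d) :=
  j.tr h ![a, b, c, d]

theorem tr5 (P : Set ZFSet.{u} → ZFSet.{u} → ZFSet.{u} → ZFSet.{u} → ZFSet.{u} → ZFSet.{u} → Prop)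
    (h : Dfb Nice (n := 5) (fun C v => P C (v 0) (v 1) (v 2) (v 3) (v 4))) (a b c d e : ZFSet.{u}) :
    P Set.univ a b c d e ↔ P M (j a) (j b) (j c) (j d) (j e) :=
  j.tr h ![a, b, c, d, e]

theorem tr6 (P : Set ZFSet.{u} → ZFSet.{u} → ZFSet.{u} → ZFSet.{u} → ZFSet.{u} → ZFSet.{u} → ZFSet.{u} → Prop)
    (h : Dfb Nice (n := 6) (fun C v => P C (v 0) (v 1) (v 2) (v 3) (v 4) (v 5))) (a b c d e f : ZFSet.{u}) :
    P Set.univ a b c d e f ↔ P M (j a) (j b) (j c) (j d) (j e) (j f) :=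
  j.tr h ![a, b, c, d, e, f]

theorem mem_iff {x y : ZFSet.{u}} : j x ∈ j y ↔ x ∈ y :=
  (j.tr (Dfb.memV (n := 2) 0 1) ![x, y]).symm
theorem eq_iff {x y : ZFSet.{u}} : j x = j y ↔ x = y :=
  (j.tr (Dfb.eqV (n := 2) 0 1) ![x, y]).symm

theorem tm {n : ℕ} {t : (Fin n → ZFSet.{u}) → ZFSet.{u}} (h : Tm Nice t) (v : Fin n → ZFSet.{u}) :
    j (t v) = t (fun i => j (v i)) := by
  have := (j.tr h.2 (Fin.snoc v (t v))).1 (by simp)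
  simp only [Fin.snoc_last] at this
  rw [this]
  congr 1
  funext i
  simp [Fin.init]

theorem pair (x y : ZFSet.{u}) : j (ZFSet.pair x y) = ZFSet.pair (j x) (j y) :=
  j.tm (t := fun v : Fin 2 → ZFSet.{u} => ZFSet.pair (v 0) (v 1))
    (Tm.pair (Tm.var ⟨_, fun _ => rfl⟩) (Tm.var ⟨_, fun _ => rfl⟩)) ![x, y]
theorem app (x y : ZFSet.{u}) : j (WSC.app x y) = WSC.app (j x) (j y) :=
  j.tm (t := fun v : Fin 2 → ZFSet.{u} => WSC.app (v 0) (v 1))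
    (Tm.app (Tm.var ⟨_, fun _ => rfl⟩) (Tm.var ⟨_, fun _ => rfl⟩)) ![x, y]

theorem subset {x y : ZFSet.{u}} (h : x ⊆ y) : j x ⊆ j y := by
  have hd : Dfb (Nice : Set ZFSet.{u} → Prop) (fun _ (v : Fin 2 → ZFSet.{u}) => ∀ z ∈ v 0, z ∈ v 1) := by
    repeat' first
      | apply Dfb.allB | apply Dfb.mem
      | exact Tm.var ⟨_, fun _ => rfl⟩
  exact (j.tr hd ![x, y]).1 (fun z hz => h hz)
end VEmb

/-! ### Coding functions as sets -/

noncomputable def img (d : ZFSet.{u}) (f : ZFSet.{u} → ZFSet.{u}) : ZFSet.{u} :=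
  ZFSet.range (fun x : {x // x ∈ d} => f x)

theorem mem_img {d y : ZFSet.{u}} {f : ZFSet.{u} → ZFSet.{u}} : y ∈ img d f ↔ ∃ x ∈ d, f x = y := by
  simp [img]

noncomputable def mk (Q : ZFSet.{u}) (f : ZFSet.{u} → ZFSet.{u}) : ZFSet.{u} :=
  ZFSet.sUnion (img Q fun x => img (f x) fun z => ZFSet.pair x z)

theorem mem_mk {Q p : ZFSet.{u}} {f : ZFSet.{u} → ZFSet.{u}} :
    p ∈ mk Q f ↔ ∃ x ∈ Q, ∃ z ∈ f x, p = ZFSet.pair x z := by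
  simp only [mk, ZFSet.mem_sUnion, mem_img]
  constructor
  · rintro ⟨_, ⟨x, hx, rfl⟩, h⟩
    obtain ⟨z, hz, rfl⟩ := mem_img.1 h
    exact ⟨x, hx, z, hz, rfl⟩
  · rintro ⟨x, hx, z, hz, rfl⟩
    exact ⟨_, ⟨x, hx, rfl⟩, mem_img.2 ⟨z, hz, rfl⟩⟩

theorem app_mk {Q x : ZFSet.{u}} {f : ZFSet.{u} → ZFSet.{u}} (hx : x ∈ Q) : app (mk Q f) x = f x := by
  ext z
  rw [mem_app, mem_mk]
  constructor
  · rintro ⟨x', _, z', hz, h⟩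
    obtain ⟨rfl, rfl⟩ := ZFSet.pair_inj.1 h
    exact hz
  · intro hz; exact ⟨x, hx, z, hz, rfl⟩

/-- The graph of a function. -/
noncomputable def gr (Q : ZFSet.{u}) (f : ZFSet.{u} → ZFSet.{u}) : ZFSet.{u} :=
  img Q fun x => ZFSet.pair x (f x)

theorem pair_mem_gr {Q x y : ZFSet.{u}} {f : ZFSet.{u} → ZFSet.{u}} :
    ZFSet.pair x y ∈ gr Q f ↔ x ∈ Q ∧ f x = y := by
  simp only [gr, mem_img, ZFSet.pair_inj]
  constructor
  · rintro ⟨x', h, rfl, rfl⟩; exact ⟨h, rfl⟩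
  · rintro ⟨h, rfl⟩; exact ⟨x, h, rfl, rfl⟩

theorem isFuncOn_gr (Q : ZFSet.{u}) (f : ZFSet.{u} → ZFSet.{u}) : IsFuncOn Q (gr Q f) := by
  constructor
  · intro p hp
    obtain ⟨x, hx, rfl⟩ := mem_img.1 hp
    exact ⟨x, _, hx, rfl⟩
  · intro a ha
    exact ⟨f a, pair_mem_gr.2 ⟨ha, rfl⟩, fun y hy => (pair_mem_gr.1 hy).2.symm⟩

/-! ### Ordinals -/

theorem isOrd_iff {x : ZFSet.{u}} : IsOrd x ↔ x.IsOrdinal :=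
  ZFSet.isOrdinal_iff_forall_mem_isTransitive.symm

theorem IsOrd.mem {x y : ZFSet.{u}} (h : IsOrd x) (hy : y ∈ x) : IsOrd y :=
  isOrd_iff.2 ((isOrd_iff.1 h).mem hy)
theorem IsOrd.trans {x y z : ZFSet.{u}} (h : IsOrd x) (hy : y ∈ x) (hz : z ∈ y) : z ∈ x :=
  h.1 y hy hz
theorem IsOrd.rank_lt {x y : ZFSet.{u}} (h : IsOrd x) (h' : IsOrd y) : x.rank < y.rank ↔ x ∈ y :=
  ZFSet.IsOrdinal.rank_lt_iff_mem (isOrd_iff.1 h) (isOrd_iff.1 h')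
theorem IsOrd.mem_of_rank {κ : ZFSet.{u}} (h : IsOrd κ) {o : Ordinal.{u}} (ho : o < κ.rank) :
    o.toZFSet ∈ κ := by
  rw [← (isOrd_iff.1 h).toZFSet_rank_eq]
  exact Ordinal.mem_toZFSet_iff.2 ⟨o, ho, rfl⟩

theorem dfb_isOrd : Dfb (Nice : Set ZFSet.{u} → Prop) (n := 1)
    (fun _ v => (∀ y ∈ v 0, ∀ z ∈ y, z ∈ v 0) ∧ ∀ y ∈ v 0, ∀ z ∈ y, ∀ w ∈ z, w ∈ y) := by
  repeat' first
    | apply Dfb.and | apply Dfb.allB | apply Dfb.mem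
    | exact Tm.var ⟨_, fun _ => rfl⟩

namespace VEmb
variable {M : Set ZFSet.{u}} (j : VEmb M)

theorem isOrd {x : ZFSet.{u}} (h : IsOrd x) : IsOrd (j x) := by
  have := (j.tr dfb_isOrd ![x]).1 ⟨fun y hy z hz => h.1 y hy hz, fun y hy z hz w hw => h.2 y hy z hz hw⟩
  exact ⟨fun y hy z hz => this.1 y hy z hz, fun y hy z hz w hw => this.2 y hy z hz w hw⟩

theorem crit_mem {κ : ZFSet.{u}} (h : IsCrit j.toElemEmb κ) : κ ∈ j κ := by
  rcases ZFSet.IsOrdinal.mem_trichotomous (isOrd_iff.1 h.1) (isOrd_iff.1 (j.isOrd h.1)) with h1 | h1 | h1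
  · exact h1
  · exact absurd h1.symm h.2.1
  · have h2 := h.2.2 _ h1
    have h3 := j.mem_iff.2 h1
    have h4 : j (j κ) = j κ := h2
    rw [h4] at h3
    exact absurd h3 (ZFSet.mem_irrefl _)

def FixP (_ : Set ZFSet.{u}) (x T a p : ZFSet.{u}) : Prop :=
  (∀ y ∈ x, y ∈ T) ∧ (∀ y ∈ T, ∃ r ∈ a, ZFSet.pair y r ∈ p) ∧
      ∀ y ∈ T, ∀ z ∈ y, z ∈ T ∧ ∀ r ∈ a, ZFSet.pair y r ∈ p → ∃ r' ∈ r, ZFSet.pair z r' ∈ p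

theorem dfb_fix : Dfb (Nice : Set ZFSet.{u} → Prop) (n := 4)
    (fun C v => FixP C (v 0) (v 1) (v 2) (v 3)) := by
  unfold FixP
  repeat' first
    | apply Dfb.and | apply Dfb.allB | apply Dfb.exB | apply Dfb.mem | apply Dfb.imp | apply Tm.pair
    | exact Tm.var ⟨_, fun _ => rfl⟩

theorem crit_fix {κ : ZFSet.{u}} (h : IsCrit j.toElemEmb κ) :
    ∀ (o : Ordinal.{u}) (x : ZFSet.{u}), x.rank = o → x.rank < κ.rank → j x = x := by
  intro o
  induction o using WellFoundedLT.induction with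
  | ind o ih =>
  rintro x rfl hx
  set α := x.rank.toZFSet with hα
  have hακ : α ∈ κ := h.1.mem_of_rank hx
  have hjα : j α = α := h.2.2 _ hακ
  set T := ZFSet.vonNeumann x.rank with hT
  set ρ := gr T (fun y => y.rank.toZFSet) with hρ
  have key := (j.tr4 _ dfb_fix x T α ρ).1 (by
    refine ⟨ZFSet.subset_vonNeumann_self x, ?_, ?_⟩
    · intro y hy
      refine ⟨y.rank.toZFSet, ?_, pair_mem_gr.2 ⟨hy, rfl⟩⟩
      exact Ordinal.mem_toZFSet_iff.2 ⟨_, ZFSet.mem_vonNeumann.1 hy, rfl⟩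
    · intro y hy z hz
      have hzT : z ∈ T := ZFSet.isTransitive_vonNeumann _ _ hy hz
      refine ⟨hzT, fun r _ hyr => ?_⟩
      obtain ⟨-, rfl⟩ := pair_mem_gr.1 hyr
      exact ⟨z.rank.toZFSet, Ordinal.mem_toZFSet_iff.2 ⟨_, ZFSet.rank_lt_of_mem hz, rfl⟩,
        pair_mem_gr.2 ⟨hzT, rfl⟩⟩)
  unfold FixP at key
  rw [hjα] at key
  obtain ⟨k1, k2, k3⟩ := key
  have hαo : IsOrd α := h.1.mem hακ
  have main : ∀ y : ZFSet.{u}, y ∈ j T → ∀ r ∈ α, ZFSet.pair y r ∈ j ρ → y.rank ≤ r.rank := by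
    intro y
    induction y using ZFSet.inductionOn with
    | _ y ihy =>
    intro hy r hr hyr
    rw [ZFSet.rank_le_iff]
    intro z hz
    obtain ⟨hzT, h2⟩ := k3 y hy z hz
    obtain ⟨r', hr', hzr⟩ := h2 r hr hyr
    exact (ihy z hz hzT r' (hαo.trans hr hr') hzr).trans_lt (ZFSet.rank_lt_of_mem hr')
  ext z
  constructor
  · intro hz
    obtain ⟨r, hr, hzr⟩ := k2 z (k1 z hz)
    have h1 := main z (k1 z hz) r hr hzr
    have h2 : r.rank < x.rank := by
      have := ZFSet.rank_lt_of_mem hr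
      rwa [hα, Ordinal.rank_toZFSet] at this
    have h3 := h1.trans_lt h2
    have := ih _ h3 z rfl (h3.trans hx)
    rw [← this] at hz
    exact j.mem_iff.1 hz
  · intro hz
    have h3 := ZFSet.rank_lt_of_mem hz
    have := ih _ h3 z rfl (h3.trans hx)
    rw [← this]
    exact j.mem_iff.2 hz

theorem fix {κ x : ZFSet.{u}} (h : IsCrit j.toElemEmb κ) (hx : x.rank < κ.rank) : j x = x :=
  j.crit_fix h _ x rfl hx

theorem crit_lim {κ α : ZFSet.{u}} (h : IsCrit j.toElemEmb κ) (hα : α ∈ κ) : ∃ β ∈ κ, α ∈ β := by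
  have hd : Dfb (Nice : Set ZFSet.{u} → Prop) (n := 2) (fun _ v => ∃ b ∈ v 1, v 0 ∈ b) := by
    repeat' first
      | apply Dfb.exB | apply Dfb.mem
      | exact Tm.var ⟨_, fun _ => rfl⟩
  refine (j.tr hd ![α, κ]).2 ⟨κ, j.crit_mem h, ?_⟩
  show j α ∈ κ
  rw [show j α = α from h.2.2 _ hα]
  exact hα

theorem crit_nosurj {κ T : ZFSet.{u}} (h : IsCrit j.toElemEmb κ) (hT : T.rank < κ.rank)
    (f : ZFSet.{u} → ZFSet.{u}) : ∃ η ∈ κ, ∀ t ∈ T, f t ≠ η := by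
  by_contra hcon
  push Not at hcon
  have hd : Dfb (Nice : Set ZFSet.{u} → Prop) (n := 3)
      (fun _ v => ∀ η ∈ v 0, ∃ t ∈ v 1, ZFSet.pair t η ∈ v 2) := by
    repeat' first
      | apply Dfb.exB | apply Dfb.allB | apply Dfb.mem | apply Tm.pair
      | exact Tm.var ⟨_, fun _ => rfl⟩
  have hd2 : Dfb (Nice : Set ZFSet.{u} → Prop) (n := 4)
      (fun _ v => ∀ η ∈ v 0, ZFSet.pair (v 1) η ∈ v 2 → η = v 3) := by
    repeat' first
      | apply Dfb.imp | apply Dfb.allB | apply Dfb.mem | apply Dfb.eq | apply Tm.pair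
      | exact Tm.var ⟨_, fun _ => rfl⟩
  obtain ⟨t, ht, htH⟩ := (j.tr hd ![κ, T, gr T f]).1 (fun η hη => by
    obtain ⟨t, ht, h⟩ := hcon η hη
    exact ⟨t, ht, pair_mem_gr.2 ⟨ht, h⟩⟩) κ (j.crit_mem h)
  change t ∈ j T at ht
  rw [j.fix h hT] at ht
  have h2 := (j.tr hd2 ![κ, t, gr T f, f t]).1 (fun η _ hp => (pair_mem_gr.1 hp).2.symm) κ (j.crit_mem h)
  have hjt : j t = t := j.fix h ((ZFSet.rank_lt_of_mem ht).trans hT)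
  have h3 : κ = j (f t) := h2 (by
    show ZFSet.pair (j t) κ ∈ j (gr T f)
    rw [hjt]; exact htH)
  have h4 : f t ∈ κ := j.mem_iff.1 (h3 ▸ j.crit_mem h)
  have h5 : j (f t) = f t := h.2.2 _ h4
  rw [← h3.trans h5] at h4
  exact ZFSet.mem_irrefl _ h4

end VEmb

/-- The combinatorial facts about critical points that are used later on. -/
structure Lg (κ : ZFSet.{u}) : Prop where
  ord : IsOrd κ
  lim : ∀ α ∈ κ, ∃ β ∈ κ, α ∈ β
  nosurj : ∀ (T : ZFSet.{u}) (f : ZFSet.{u} → ZFSet.{u}), T.rank < κ.rank → ∃ η ∈ κ, ∀ t ∈ T, f t ≠ η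

theorem VEmb.lg {M : Set ZFSet.{u}} (j : VEmb M) {κ : ZFSet.{u}} (h : IsCrit j.toElemEmb κ) : Lg κ :=
  ⟨h.1, fun _ hα => j.crit_lim h hα, fun _ f hT => j.crit_nosurj h hT f⟩

namespace Lg
variable {κ : ZFSet.{u}}

theorem succ_lt (h : Lg κ) {o : Ordinal.{u}} (ho : o < κ.rank) : Order.succ o < κ.rank := by
  obtain ⟨β, hβ, h1⟩ := h.lim _ (h.ord.mem_of_rank ho)
  have := ZFSet.rank_lt_of_mem h1
  rw [Ordinal.rank_toZFSet] at this
  exact (Order.succ_le_of_lt this).trans_lt (ZFSet.rank_lt_of_mem hβ)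

theorem rank_pair (h : Lg κ) {x y : ZFSet.{u}} (hx : x.rank < κ.rank) (hy : y.rank < κ.rank) :
    (ZFSet.pair x y).rank < κ.rank := by
  have h1 := h.succ_lt hx
  have h2 := h.succ_lt hy
  simp only [ZFSet.pair, ZFSet.rank_pair, ZFSet.rank_singleton]
  have := h.succ_lt (max_lt h1 h2)
  exact max_lt (h.succ_lt h1) this

theorem rank_prod (h : Lg κ) {x y : ZFSet.{u}} (hx : x.rank < κ.rank) (hy : y.rank < κ.rank) :
    (ZFSet.prod x y).rank < κ.rank := by
  set m := max x.rank y.rank with hm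
  have hmk : m < κ.rank := max_lt hx hy
  refine lt_of_le_of_lt ?_ (h.succ_lt (h.succ_lt hmk))
  rw [ZFSet.rank_le_iff]
  intro p hp
  obtain ⟨a, ha, b, hb, rfl⟩ := ZFSet.mem_prod.1 hp
  have h1 : Order.succ a.rank ≤ m := Order.succ_le_of_lt ((ZFSet.rank_lt_of_mem ha).trans_le (le_max_left _ _))
  have h2 : Order.succ b.rank ≤ m := Order.succ_le_of_lt ((ZFSet.rank_lt_of_mem hb).trans_le (le_max_right _ _))
  simp only [ZFSet.pair, ZFSet.rank_pair, ZFSet.rank_singleton]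
  rw [← Order.succ_max]
  refine Order.succ_lt_succ (max_lt ?_ ?_)
  · exact Order.lt_succ_of_le h1
  · exact Order.lt_succ_of_le (max_le h1 h2)

/-- An image of a set in `V_κ` has size `< κ`. -/
theorem cardLt (h : Lg κ) {T d : ZFSet.{u}} (hT : T.rank < κ.rank) (f : ZFSet.{u} → ZFSet.{u})
    (hf : ∀ x ∈ d, ∃ t ∈ T, f t = x) : CardLtIn Set.univ d κ := by
  classical
  let e := equivShrink {x // x ∈ d}
  let r : Shrink.{u} {x // x ∈ d} → Shrink.{u} {x // x ∈ d} → Prop := WellOrderingRel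
  let g : ZFSet.{u} → ZFSet.{u} := fun x => if hx : x ∈ d then (Ordinal.typein r (e ⟨x, hx⟩)).toZFSet else ∅
  have hg : ∀ x (hx : x ∈ d), g x = (Ordinal.typein r (e ⟨x, hx⟩)).toZFSet := fun x hx => dif_pos hx
  by_cases hlt : Ordinal.type r < κ.rank
  · refine ⟨(Ordinal.type r).toZFSet, gr d g, h.ord.mem_of_rank hlt, trivial, isFuncOn_gr _ _, ?_, ?_⟩
    · intro x y hxy
      obtain ⟨hx, rfl⟩ := pair_mem_gr.1 hxy
      rw [hg x hx]
      exact Ordinal.mem_toZFSet_iff.2 ⟨_, Ordinal.typein_lt_type r _, rfl⟩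
    · intro x x' y hxy hxy'
      obtain ⟨hx, rfl⟩ := pair_mem_gr.1 hxy
      obtain ⟨hx', h'⟩ := pair_mem_gr.1 hxy'
      rw [hg x hx, hg x' hx'] at h'
      have h1 := Ordinal.toZFSet_injective h'
      rw [Ordinal.typein_inj] at h1
      have := e.injective h1
      exact (congrArg Subtype.val this).symm
  · exfalso
    obtain ⟨η, hη, hne⟩ := h.nosurj T (fun t => g (f t)) hT
    have h1 : η.rank < Ordinal.type r := (ZFSet.rank_lt_of_mem hη).trans_le (not_lt.1 hlt)
    obtain ⟨a, ha⟩ := Ordinal.typein_surj r h1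
    obtain ⟨⟨x, hx⟩, rfl⟩ := e.surjective a
    obtain ⟨t, ht, rfl⟩ := hf x hx
    apply hne t ht
    show g (f t) = η
    rw [hg _ hx, ha]
    exact (isOrd_iff.1 (h.ord.mem hη)).toZFSet_rank_eq
end Lg

/-! ### Mostowski collapse -/

theorem mostowski {τ : Type (u+1)} (E Q : τ → τ → Prop) (wf : WellFounded E)
    (symm : ∀ s t, Q s t → Q t s)
    (cl : ∀ s s' t, Q s s' → E s t → E s' t) (cr : ∀ s t t', Q t t' → E s t → E s t')
    (ext : ∀ s t, (∀ r, E r s ↔ E r t) → Q s t)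
    (small : ∀ t, ∃ D : Set τ, Small.{u} D ∧ (∀ r ∈ D, E r t) ∧ ∀ r, E r t → ∃ r' ∈ D, Q r r') :
    ∃ π : τ → ZFSet.{u}, (∀ s t, π s = π t ↔ Q s t) ∧ (∀ s t, π s ∈ π t ↔ E s t) ∧
      ∀ t x, x ∈ π t → ∃ s, π s = x := by
  choose D hsm hD1 hD2 using small
  let π : τ → ZFSet.{u} := wf.fix (C := fun _ => ZFSet.{u}) (fun t ih =>
    have := hsm t
    ZFSet.range (fun r : D t => ih r.1 (hD1 t r.1 r.2)))
  have hπ : ∀ t x, x ∈ π t ↔ ∃ r ∈ D t, π r = x := by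
    intro t x
    have := hsm t
    have : π t = ZFSet.range (fun r : D t => π r.1) := by
      show wf.fix _ t = _
      rw [wf.fix_eq]
    rw [this, ZFSet.mem_range]
    simp
  have A : ∀ r t, Q r t → π r = π t := by
    intro r
    induction r using wf.induction with
    | _ r ih =>
    intro t hrt
    ext x
    rw [hπ, hπ]
    constructor
    · rintro ⟨s, hs, rfl⟩
      obtain ⟨s', hs', h⟩ := hD2 t s (cr _ _ _ hrt (hD1 _ _ hs))
      exact ⟨s', hs', (ih s (hD1 _ _ hs) s' h).symm⟩
    · rintro ⟨s', hs', rfl⟩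
      obtain ⟨s, hs, h⟩ := hD2 r s' (cr _ _ _ (symm _ _ hrt) (hD1 _ _ hs'))
      exact ⟨s, hs, ih s (hD1 _ _ hs) s' (symm _ _ h)⟩
  have B : ∀ r t, π r = π t → Q r t := by
    intro r
    induction r using wf.induction with
    | _ r ih =>
    intro t hrt
    refine ext _ _ fun s => ⟨fun hs => ?_, fun hs => ?_⟩
    · obtain ⟨s0, hs0, h⟩ := hD2 r s hs
      obtain ⟨s', hs', h'⟩ := (hπ t _).1 (hrt ▸ (hπ r (π s0)).2 ⟨s0, hs0, rfl⟩)
      have h2 := ih s0 (hD1 _ _ hs0) s' h'.symm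
      exact cl _ _ _ (symm _ _ h) (cl _ _ _ (symm _ _ h2) (hD1 _ _ hs'))
    · obtain ⟨s0, hs0, h⟩ := hD2 t s hs
      obtain ⟨s', hs', h'⟩ := (hπ r _).1 (hrt ▸ (hπ t (π s0)).2 ⟨s0, hs0, rfl⟩)
      have h2 := ih s' (hD1 _ _ hs') s0 h'
      exact cl _ _ _ (symm _ _ h) (cl _ _ _ h2 (hD1 _ _ hs'))
  refine ⟨π, fun s t => ⟨B s t, A s t⟩, fun s t => ?_, fun t x hx => ?_⟩
  · rw [hπ]
    constructor
    · rintro ⟨r, hr, h⟩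
      exact cl _ _ _ (B _ _ h) (hD1 _ _ hr)
    · intro h
      obtain ⟨r, hr, h'⟩ := hD2 t s h
      exact ⟨r, hr, (A _ _ h').symm⟩
  · obtain ⟨r, _, h⟩ := (hπ t x).1 hx
    exact ⟨r, h⟩

/-! ### Projections -/
open Classical in
noncomputable def fs (p : ZFSet.{u}) : ZFSet.{u} := if h : ∃ x y, p = ZFSet.pair x y then h.choose else ∅
open Classical in
noncomputable def sn (p : ZFSet.{u}) : ZFSet.{u} := if h : ∃ y x, p = ZFSet.pair x y then h.choose else ∅

@[simp] theorem fs_pair (x y : ZFSet.{u}) : fs (ZFSet.pair x y) = x := by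
  have h : ∃ x' y', ZFSet.pair x y = ZFSet.pair x' y' := ⟨x, y, rfl⟩
  unfold fs
  rw [dif_pos h]
  obtain ⟨y', h'⟩ := h.choose_spec
  exact (ZFSet.pair_inj.1 h').1.symm
@[simp] theorem sn_pair (x y : ZFSet.{u}) : sn (ZFSet.pair x y) = y := by
  have h : ∃ y' x', ZFSet.pair x y = ZFSet.pair x' y' := ⟨y, x, rfl⟩
  unfold sn
  rw [dif_pos h]
  obtain ⟨y', h'⟩ := h.choose_spec
  exact (ZFSet.pair_inj.1 h').2.symm

/-! ### Definable subsets -/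
theorem VEmb.sep_iff {M : Set ZFSet.{u}} (k : VEmb M)
    (R : Set ZFSet.{u} → ZFSet.{u} → ZFSet.{u} → ZFSet.{u} → ZFSet.{u} → Prop)
    (hR : Dfb Nice (n := 4) (fun C v => R C (v 0) (v 1) (v 2) (v 3))) (D p q r s : ZFSet.{u}) :
    s ∈ k (ZFSet.sep (fun d => R Set.univ d p q r) D) ↔ s ∈ k D ∧ R M s (k p) (k q) (k r) := by
  have hd : Dfb (Nice : Set ZFSet.{u} → Prop) (n := 5) (fun C v =>
      ∀ d ∈ C, (d ∈ v 0 ↔ d ∈ v 1 ∧ R C d (v 2) (v 3) (v 4))) := by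
    apply Dfb.allC
    apply Dfb.iff
    · apply Dfb.mem <;> exact Tm.var ⟨_, fun _ => rfl⟩
    · apply Dfb.and
      · apply Dfb.mem <;> exact Tm.var ⟨_, fun _ => rfl⟩
      · exact hR.ren (m := 6) ![5, 2, 3, 4]
  have := (k.tr5 (fun C X D p q r => ∀ d ∈ C, (d ∈ X ↔ d ∈ D ∧ R C d p q r)) hd
    (ZFSet.sep (fun d => R Set.univ d p q r) D) D p q r).1 (fun d _ => ZFSet.mem_sep)
  constructor
  · intro h
    exact (this s (k.trM _ (k.mem_M _) _ h)).1 h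
  · intro h
    exact (this s (k.trM _ (k.mem_M _) _ h.1)).2 h

/-! ### The combinatorial consequence of supercompactness below `κ` -/

def Good (C : Set ZFSet.{u}) (D K L S U : ZFSet.{u}) : Prop :=
  (∀ x ∈ S, x ∈ K) ∧ (∀ x ∈ S, ∀ y ∈ x, y ∈ S) ∧ (∀ x ∈ S, ∀ y ∈ S, ZFSet.pair x y ∈ S) ∧
  (∀ X ∈ U, ∀ Y ∈ U, ∃ Z ∈ U, ∀ z ∈ Z, z ∈ X ∧ z ∈ Y) ∧
  (∀ X ∈ U, ∃ d ∈ X, d ∈ D) ∧ (∃ X ∈ U, ∀ d ∈ X, d ∈ D) ∧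
  (∀ Z ∈ C, ∀ a ∈ S, ∃ X ∈ U, (∀ d ∈ X, ZFSet.pair d a ∈ Z) ∨ (∀ d ∈ X, ¬ ZFSet.pair d a ∈ Z)) ∧
  (∀ ξ ∈ L, ∀ c ∈ S, ∃ X ∈ U, ∀ d ∈ X, ZFSet.pair ξ c ∈ d) ∧
  (∀ F ∈ C, ∀ b ∈ S, ∀ c ∈ S, ∀ X ∈ U, (∀ d ∈ X, app F (ZFSet.pair d b) ∈ c) →
    ∃ c' ∈ c, ∃ Y ∈ U, ∀ d ∈ Y, app F (ZFSet.pair d b) = c') ∧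
  (∀ Sg ∈ C, ∃ r ∈ C, ∀ F ∈ Sg, ∀ G ∈ Sg, ∀ a ∈ S, ∀ b ∈ S, ∀ X ∈ U,
    (∀ d ∈ X, app F (ZFSet.pair d a) ∈ app G (ZFSet.pair d b)) →
      app r (ZFSet.pair F a) ∈ app r (ZFSet.pair G b))

def Phi (C : Set ZFSet.{u}) (D K L : ZFSet.{u}) : Prop :=
  ∀ x ∈ K, ∃ S ∈ C, ∃ U ∈ C, x ∈ S ∧ Good C D K L S U

theorem dfb_phi : Dfb (Nice : Set ZFSet.{u} → Prop) (n := 3) (fun C v => Phi C (v 0) (v 1) (v 2)) := by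
  unfold Phi Good
  repeat' first
    | apply Dfb.and | apply Dfb.exC | apply Dfb.allC | apply Dfb.allB | apply Dfb.exB
    | apply Dfb.mem | apply Dfb.eq | apply Dfb.not | apply Dfb.or | apply Dfb.imp | apply Tm.pair | apply Tm.app
    | exact Tm.var ⟨_, fun _ => rfl⟩

noncomputable def KK (κ : ZFSet.{u}) : ZFSet.{u} := ZFSet.vonNeumann κ.rank
noncomputable def DD (κ L : ZFSet.{u}) : ZFSet.{u} :=
  ZFSet.sep (fun d => CardLtIn Set.univ d κ) (ZFSet.powerset (ZFSet.prod L (KK κ)))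

theorem mem_KK {κ x : ZFSet.{u}} : x ∈ KK κ ↔ x.rank < κ.rank := ZFSet.mem_vonNeumann
theorem mem_DD {κ L d : ZFSet.{u}} : d ∈ DD κ L ↔ d ⊆ ZFSet.prod L (KK κ) ∧ CardLtIn Set.univ d κ := by
  simp [DD]

def SeedP (C : Set ZFSet.{u}) (κ K D L : ZFSet.{u}) : Prop :=
  ∀ β ∈ κ, ∀ g ∈ C, ∀ S ∈ K, (∀ η ∈ β, ∀ y ∈ C, ∀ y' ∈ C, ZFSet.pair η y ∈ g → ZFSet.pair η y' ∈ g → y = y') →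
    ∃ d ∈ D, ∀ x ∈ C, (x ∈ d ↔ ∃ η ∈ β, ∃ c ∈ S, ∃ ξ ∈ L, ZFSet.pair η ξ ∈ g ∧ x = ZFSet.pair ξ c)

theorem dfb_seed : Dfb (Nice : Set ZFSet.{u} → Prop) (n := 4)
    (fun C v => SeedP C (v 0) (v 1) (v 2) (v 3)) := by
  unfold SeedP
  repeat' first
    | apply Dfb.and | apply Dfb.exC | apply Dfb.allC | apply Dfb.allB | apply Dfb.exB
    | apply Dfb.mem | apply Dfb.eq | apply Dfb.iff | apply Dfb.imp | apply Tm.pair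
    | exact Tm.var ⟨_, fun _ => rfl⟩

theorem seed_V {κ : ZFSet.{u}} (h : Lg κ) (L : ZFSet.{u}) : SeedP Set.univ κ (KK κ) (DD κ L) L := by
  intro β hβ g _ S hS hg
  rw [mem_KK] at hS
  refine ⟨ZFSet.sep (fun x => ∃ η ∈ β, ∃ c ∈ S, ∃ ξ ∈ L, ZFSet.pair η ξ ∈ g ∧ x = ZFSet.pair ξ c)
    (ZFSet.prod L S), ?_, ?_⟩
  · rw [mem_DD]
    refine ⟨fun x hx => ?_, ?_⟩
    · obtain ⟨ξ, hξ, c, hc, rfl⟩ := ZFSet.mem_prod.1 (ZFSet.mem_sep.1 hx).1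
      exact ZFSet.pair_mem_prod.2 ⟨hξ, mem_KK.2 ((ZFSet.rank_lt_of_mem hc).trans hS)⟩
    · classical
      refine h.cardLt (T := ZFSet.prod β S) (h.rank_prod (ZFSet.rank_lt_of_mem hβ) hS)
        (fun p => if hp : ∃ ξ, ZFSet.pair (fs p) ξ ∈ g then ZFSet.pair hp.choose (sn p) else ∅) ?_
      intro x hx
      obtain ⟨η, hη, c, hc, ξ, hξ, hp, rfl⟩ := (ZFSet.mem_sep.1 hx).2
      refine ⟨ZFSet.pair η c, ZFSet.pair_mem_prod.2 ⟨hη, hc⟩, ?_⟩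
      have hex : ∃ ξ, ZFSet.pair (fs (ZFSet.pair η c)) ξ ∈ g := ⟨ξ, by simpa using hp⟩
      show dite _ _ _ = _
      rw [dif_pos hex]
      have := hex.choose_spec
      generalize hex.choose = ξ' at this
      rw [fs_pair] at this
      rw [sn_pair, hg η hη ξ' trivial ξ trivial this hp]
  · intro x _
    rw [ZFSet.mem_sep]
    refine ⟨fun hx => hx.2, fun hx => ⟨?_, hx⟩⟩
    obtain ⟨η, hη, c, hc, ξ, hξ, hp, rfl⟩ := hx
    exact ZFSet.pair_mem_prod.2 ⟨hξ, hc⟩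

theorem phi_V {κ L : ZFSet.{u}} (h : Lg κ)
    (hlim : ∀ α ∈ κ, ∃ μ ∈ κ, α ∈ μ ∧ LamSupercompact μ L) :
    Phi Set.univ (DD κ L) (KK κ) L := by
  intro x hx
  rw [mem_KK] at hx
  obtain ⟨μ0, hμ0, hx0, M0, -, hM0, j0, hj0, -, -⟩ := hlim _ (h.ord.mem_of_rank hx)
  obtain ⟨μ, hμ, hμμ, M, -, hM, k', hk, hLk, hcl⟩ := hlim μ0 hμ0
  let k0 : VEmb M0 := { j0 with trM := hM0 }
  let k : VEmb M := { k' with trM := hM }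
  have lg0 : Lg μ0 := k0.lg hj0
  change IsCrit k.toElemEmb μ at hk
  change L ∈ k μ at hLk
  have hxμ : x.rank < μ0.rank := by
    have := ZFSet.rank_lt_of_mem hx0
    rwa [Ordinal.rank_toZFSet] at this
  set S := KK μ0 with hS
  have hSr : S.rank < μ.rank := by
    rw [hS, KK, ZFSet.rank_vonNeumann]; exact ZFSet.rank_lt_of_mem hμμ
  have hμκ : μ.rank < κ.rank := ZFSet.rank_lt_of_mem hμ
  have hkS : k S = S := k.fix hk hSr
  have fixS : ∀ c ∈ S, k c = c := fun c hc => k.fix hk ((ZFSet.rank_lt_of_mem hc).trans hSr)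
  have hLκ : L ∈ k κ := (k.isOrd h.ord).trans (k.mem_iff.2 hμ) hLk
  have hgM : gr L k ∈ M := by
    refine hcl _ trivial (isFuncOn_gr _ _) ?_
    intro a b hab
    obtain ⟨-, rfl⟩ := pair_mem_gr.1 hab
    exact k.mem_M a
  obtain ⟨s, hsD, hs⟩ := (k.tr4 _ dfb_seed κ (KK κ) (DD κ L) L).1 (seed_V h L) L hLκ (gr L k) hgM S
    (by
      rw [← hkS]
      exact k.mem_iff.2 (mem_KK.2 (hSr.trans hμκ)))
    (by
      intro η _ y _ y' _ h1 h2
      exact (pair_mem_gr.1 h1).2.symm.trans (pair_mem_gr.1 h2).2)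
  have hs' : ∀ ξ ∈ L, ∀ c ∈ S, ZFSet.pair (k ξ) c ∈ s := by
    intro ξ hξ c hc
    have hcM : c ∈ M := by rw [← fixS c hc]; exact k.mem_M c
    refine (hs _ (k.nice.1.2 _ (k.mem_M ξ) _ hcM)).2 ⟨ξ, hξ, c, hc, k ξ, k.mem_iff.2 hξ, ?_, rfl⟩
    exact pair_mem_gr.2 ⟨hξ, rfl⟩
  set D := DD κ L with hD
  set U := ZFSet.sep (fun X => s ∈ k X) (ZFSet.powerset D) with hU
  have memU : ∀ {X}, X ∈ U ↔ X ⊆ D ∧ s ∈ k X := by intro X; simp [hU]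
  have sepU : ∀ (R : Set ZFSet.{u} → ZFSet.{u} → ZFSet.{u} → ZFSet.{u} → ZFSet.{u} → Prop)
      (_ : Dfb Nice (n := 4) (fun C v => R C (v 0) (v 1) (v 2) (v 3))) (p q r : ZFSet.{u}),
      R M s (k p) (k q) (k r) → ZFSet.sep (fun d => R Set.univ d p q r) D ∈ U := by
    intro R hR p q r hh
    refine memU.2 ⟨fun z hz => (ZFSet.mem_sep.1 hz).1, (k.sep_iff R hR D p q r s).2 ⟨hsD, hh⟩⟩
  refine ⟨S, trivial, U, trivial, mem_KK.2 hxμ, ?_, ?_, ?_, ?_, ?_, ?_, ?_, ?_, ?_, ?_⟩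
  · intro c hc
    exact mem_KK.2 ((ZFSet.rank_lt_of_mem hc).trans (hSr.trans hμκ))
  · intro c hc y hy
    exact ZFSet.isTransitive_vonNeumann _ _ hc hy
  · intro a ha b hb
    exact mem_KK.2 (lg0.rank_pair (mem_KK.1 ha) (mem_KK.1 hb))
  · intro X hX Y hY
    refine ⟨_, sepU (fun _ d X Y _ => d ∈ X ∧ d ∈ Y) ?_ X Y ∅ ⟨(memU.1 hX).2, (memU.1 hY).2⟩, ?_⟩
    · apply Dfb.and <;> apply Dfb.mem <;> exact Tm.var ⟨_, fun _ => rfl⟩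
    · intro z hz; exact (ZFSet.mem_sep.1 hz).2
  · intro X hX
    have hd : Dfb (Nice : Set ZFSet.{u} → Prop) (n := 2) (fun _ v => ∃ d ∈ v 0, d ∈ v 1) := by
      repeat' first
        | apply Dfb.exB | apply Dfb.mem
        | exact Tm.var ⟨_, fun _ => rfl⟩
    exact (k.tr2 (fun _ X D => ∃ d ∈ X, d ∈ D) hd X D).2 ⟨s, (memU.1 hX).2, hsD⟩
  · exact ⟨D, memU.2 ⟨fun _ h => h, hsD⟩, fun _ h => h⟩
  · intro Z _ a ha
    by_cases hc : ZFSet.pair s a ∈ k Z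
    · refine ⟨_, sepU (fun _ d Z a _ => ZFSet.pair d a ∈ Z) ?_ Z a ∅ ?_, Or.inl ?_⟩
      · apply Dfb.mem <;> repeat' first | apply Tm.pair | exact Tm.var ⟨_, fun _ => rfl⟩
      · rw [fixS a ha]; exact hc
      · intro z hz; exact (ZFSet.mem_sep.1 hz).2
    · refine ⟨_, sepU (fun _ d Z a _ => ¬ ZFSet.pair d a ∈ Z) ?_ Z a ∅ ?_, Or.inr ?_⟩
      · apply Dfb.not; apply Dfb.mem <;> repeat' first | apply Tm.pair | exact Tm.var ⟨_, fun _ => rfl⟩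
      · rw [fixS a ha]; exact hc
      · intro z hz; exact (ZFSet.mem_sep.1 hz).2
  · intro ξ hξ c hc
    refine ⟨_, sepU (fun _ d ξ c _ => ZFSet.pair ξ c ∈ d) ?_ ξ c ∅ ?_, ?_⟩
    · apply Dfb.mem <;> repeat' first | apply Tm.pair | exact Tm.var ⟨_, fun _ => rfl⟩
    · rw [fixS c hc]; exact hs' ξ hξ c hc
    · intro z hz; exact (ZFSet.mem_sep.1 hz).2
  · intro F _ b hb c hc X hX hF
    have hd : Dfb (Nice : Set ZFSet.{u} → Prop) (n := 4)
        (fun _ v => ∀ d ∈ v 0, app (v 1) (ZFSet.pair d (v 2)) ∈ v 3) := by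
      repeat' first
        | apply Dfb.allB | apply Dfb.mem | apply Tm.app | apply Tm.pair
        | exact Tm.var ⟨_, fun _ => rfl⟩
    have h1 := (k.tr4 (fun _ X F b c => ∀ d ∈ X, app F (ZFSet.pair d b) ∈ c) hd X F b c).1 hF s (memU.1 hX).2
    rw [fixS b hb, fixS c hc] at h1
    have hcS : app (k F) (ZFSet.pair s b) ∈ S := ZFSet.isTransitive_vonNeumann _ _ hc h1
    refine ⟨_, h1, _, sepU (fun _ d F b c' => app F (ZFSet.pair d b) = c') ?_ F b
      (app (k F) (ZFSet.pair s b)) ?_, ?_⟩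
    · apply Dfb.eq <;> repeat' first | apply Tm.app | apply Tm.pair | exact Tm.var ⟨_, fun _ => rfl⟩
    · rw [fixS b hb, fixS _ hcS]
    · intro z hz; exact (ZFSet.mem_sep.1 hz).2
  · intro Sg _
    refine ⟨mk (ZFSet.prod Sg S) (fun p => app (k (fs p)) (ZFSet.pair s (sn p))), trivial, ?_⟩
    intro F hF G hG a ha b hb X hX hFG
    rw [app_mk (ZFSet.pair_mem_prod.2 ⟨hF, ha⟩), app_mk (ZFSet.pair_mem_prod.2 ⟨hG, hb⟩)]
    simp only [fs_pair, sn_pair]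
    have hd : Dfb (Nice : Set ZFSet.{u} → Prop) (n := 5)
        (fun _ v => ∀ d ∈ v 0, app (v 1) (ZFSet.pair d (v 2)) ∈ app (v 3) (ZFSet.pair d (v 4))) := by
      repeat' first
        | apply Dfb.allB | apply Dfb.mem | apply Tm.app | apply Tm.pair
        | exact Tm.var ⟨_, fun _ => rfl⟩
    have h1 := (k.tr5 (fun _ X F a G b => ∀ d ∈ X, app F (ZFSet.pair d a) ∈ app G (ZFSet.pair d b)) hd
      X F a G b).1 hFG s (memU.1 hX).2
    rw [fixS b hb, fixS a ha] at h1
    exact h1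

/-! ### The extender-type ultrapower -/

structure Ctx (M : Set ZFSet.{u}) where
  j : VEmb M
  κ : ZFSet.{u}
  L : ZFSet.{u}
  S : ZFSet.{u}
  U : ZFSet.{u}
  crit : IsCrit j.toElemEmb κ
  good : Good M (j (DD κ L)) (j (KK κ)) (j L) S U
  hLS : L ∈ S

namespace Ctx
variable {M : Set ZFSet.{u}} (c : Ctx M)

noncomputable def D : ZFSet.{u} := DD c.κ c.L
noncomputable def K : ZFSet.{u} := KK c.κ
noncomputable def Q : ZFSet.{u} := ZFSet.prod c.D c.K

def Ev (P : ZFSet.{u} → Prop) : Prop := ∃ X ∈ c.U, ∀ d ∈ X, P d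

theorem lg : Lg c.κ := c.j.lg c.crit
theorem SK : ∀ x ∈ c.S, x ∈ c.j c.K := c.good.1
theorem Str : ∀ x ∈ c.S, ∀ y ∈ x, y ∈ c.S := c.good.2.1
theorem Spr : ∀ x ∈ c.S, ∀ y ∈ c.S, ZFSet.pair x y ∈ c.S := c.good.2.2.1

theorem Ev.mono {c : Ctx M} {P P' : ZFSet.{u} → Prop} (h : c.Ev P) (hP : ∀ d, P d → P' d) : c.Ev P' := by
  obtain ⟨X, hX, h⟩ := h
  exact ⟨X, hX, fun d hd => hP d (h d hd)⟩
theorem Ev.and {c : Ctx M} {P P' : ZFSet.{u} → Prop} (h : c.Ev P) (h' : c.Ev P') :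
    c.Ev (fun d => P d ∧ P' d) := by
  obtain ⟨X, hX, h⟩ := h
  obtain ⟨Y, hY, h'⟩ := h'
  obtain ⟨Z, hZ, hh⟩ := c.good.2.2.2.1 X hX Y hY
  exact ⟨Z, hZ, fun d hd => ⟨h d (hh d hd).1, h' d (hh d hd).2⟩⟩
theorem Ev.ex {c : Ctx M} {P : ZFSet.{u} → Prop} (h : c.Ev P) : ∃ d ∈ c.j c.D, P d := by
  obtain ⟨X, hX, h⟩ := h
  obtain ⟨d, hd, hdD⟩ := c.good.2.2.2.2.1 X hX
  exact ⟨d, hdD, h d hd⟩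
theorem ev_D : c.Ev (fun d => d ∈ c.j c.D) := c.good.2.2.2.2.2.1
theorem ev_of {P : ZFSet.{u} → Prop} (h : ∀ d ∈ c.j c.D, P d) : c.Ev P := c.ev_D.mono h

theorem K_pair {a b : ZFSet.{u}} (ha : a ∈ c.K) (hb : b ∈ c.K) : ZFSet.pair a b ∈ c.K :=
  mem_KK.2 (c.lg.rank_pair (mem_KK.1 ha) (mem_KK.1 hb))

/-- Transfer of a statement about all `d ∈ D`, `a ∈ K`. -/
theorem trDK (R : Set ZFSet.{u} → ZFSet.{u} → ZFSet.{u} → ZFSet.{u} → ZFSet.{u} → ZFSet.{u} → Prop)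
    (hR : Dfb Nice (n := 5) (fun C v => R C (v 0) (v 1) (v 2) (v 3) (v 4))) (p q r : ZFSet.{u})
    (h : ∀ d ∈ c.D, ∀ a ∈ c.K, R Set.univ d a p q r) :
    ∀ d ∈ c.j c.D, ∀ a ∈ c.j c.K, R M d a (c.j p) (c.j q) (c.j r) := by
  have hd : Dfb (Nice : Set ZFSet.{u} → Prop) (n := 5) (fun C v =>
      ∀ d ∈ v 0, ∀ a ∈ v 1, R C d a (v 2) (v 3) (v 4)) := by
    apply Dfb.allB (Tm.var ⟨_, fun _ => rfl⟩)
    apply Dfb.allB (Tm.var ⟨_, fun _ => rfl⟩)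
    exact hR.ren (m := 7) ![5, 6, 2, 3, 4]
  exact (c.j.tr5 (fun C D K p q r => ∀ d ∈ D, ∀ a ∈ K, R C d a p q r) hd c.D c.K p q r).1 h

theorem mem_Q {d a : ZFSet.{u}} (hd : d ∈ c.D) (ha : a ∈ c.K) : ZFSet.pair d a ∈ c.Q :=
  ZFSet.pair_mem_prod.2 ⟨hd, ha⟩

theorem pair_mem_Q {d a : ZFSet.{u}} (hd : d ∈ c.j c.D) (ha : a ∈ c.j c.K) :
    ZFSet.pair d a ∈ c.j c.Q := by
  refine c.trDK (fun _ d a Q _ _ => ZFSet.pair d a ∈ Q) ?_ c.Q ∅ ∅ ?_ d hd a ha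
  · apply Dfb.mem <;> repeat' first | apply Tm.pair | exact Tm.var ⟨_, fun _ => rfl⟩
  · intro d hd a ha; exact ZFSet.pair_mem_prod.2 ⟨hd, ha⟩

/-- `Y` holds almost everywhere with respect to the ultrafilter `G_a` on `Q`. -/
def Al (a : ZFSet.{u}) (Y : ZFSet.{u} → Prop) : Prop :=
  c.Ev (fun d => ZFSet.pair d a ∈ c.j (ZFSet.sep Y c.Q))

theorem Al.mono {c : Ctx M} {a : ZFSet.{u}} {Y Y' : ZFSet.{u} → Prop} (h : c.Al a Y)
    (hY : ∀ x ∈ c.Q, Y x → Y' x) : c.Al a Y' := by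
  refine Ev.mono h fun d hd => ?_
  refine c.j.subset (fun x hx => ?_) hd
  rw [ZFSet.mem_sep] at hx ⊢
  exact ⟨hx.1, hY x hx.1 hx.2⟩

theorem Al.congr {c : Ctx M} {a : ZFSet.{u}} {Y Y' : ZFSet.{u} → Prop}
    (hY : ∀ x ∈ c.Q, (Y x ↔ Y' x)) : c.Al a Y ↔ c.Al a Y' :=
  ⟨fun h => h.mono fun x hx => (hY x hx).1, fun h => h.mono fun x hx => (hY x hx).2⟩

theorem Al.and {c : Ctx M} {a : ZFSet.{u}} {Y Y' : ZFSet.{u} → Prop} (h : c.Al a Y) (h' : c.Al a Y') :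
    c.Al a (fun x => Y x ∧ Y' x) := by
  refine Ev.mono (Ev.and h h') fun d hd => ?_
  have hdf : Dfb (Nice : Set ZFSet.{u} → Prop) (n := 3)
      (fun _ v => ∀ z ∈ v 0, z ∈ v 1 → z ∈ v 2) := by
    repeat' first
      | apply Dfb.allB | apply Dfb.mem | apply Dfb.imp
      | exact Tm.var ⟨_, fun _ => rfl⟩
  refine (c.j.tr3 (fun _ X Y Z => ∀ z ∈ X, z ∈ Y → z ∈ Z) hdf _ _ _).1 ?_ _ hd.1 hd.2
  intro z h1 h2
  rw [ZFSet.mem_sep] at h1 h2 ⊢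
  exact ⟨h1.1, h1.2, h2.2⟩

theorem al_of {a : ZFSet.{u}} (ha : a ∈ c.S) {Y : ZFSet.{u} → Prop} (h : ∀ x ∈ c.Q, Y x) : c.Al a Y := by
  refine c.ev_of fun d hd => ?_
  have : ZFSet.sep Y c.Q = c.Q := by
    ext x; rw [ZFSet.mem_sep]; exact ⟨fun h => h.1, fun hx => ⟨hx, h x hx⟩⟩
  rw [this]
  exact c.pair_mem_Q hd (c.SK a ha)

theorem Al.ex {c : Ctx M} {a : ZFSet.{u}} {Y : ZFSet.{u} → Prop} (h : c.Al a Y) : ∃ x ∈ c.Q, Y x := by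
  obtain ⟨d, _, hd⟩ := Ev.ex h
  have hdf : Dfb (Nice : Set ZFSet.{u} → Prop) (n := 1) (fun _ v => ∃ z ∈ v 0, z = z) := by
    repeat' first
      | apply Dfb.exB | apply Dfb.eq
      | exact Tm.var ⟨_, fun _ => rfl⟩
  obtain ⟨z, hz, -⟩ := (c.j.tr1 (fun _ X => ∃ z ∈ X, z = z) hdf (ZFSet.sep Y c.Q)).2 ⟨_, hd, rfl⟩
  rw [ZFSet.mem_sep] at hz
  exact ⟨z, hz⟩

theorem al_not {a : ZFSet.{u}} (ha : a ∈ c.S) {Y : ZFSet.{u} → Prop} :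
    c.Al a (fun x => ¬ Y x) ↔ ¬ c.Al a Y := by
  constructor
  · intro h h'
    obtain ⟨x, _, h1, h2⟩ := (h.and h').ex
    exact h1 h2
  · intro h
    obtain ⟨X, hX, h1 | h1⟩ := c.good.2.2.2.2.2.2.1 (c.j (ZFSet.sep Y c.Q)) (c.j.mem_M _) a ha
    · exact absurd ⟨X, hX, h1⟩ h
    · have h2 : c.Ev (fun d => ¬ ZFSet.pair d a ∈ c.j (ZFSet.sep Y c.Q)) := ⟨X, hX, h1⟩
      refine (c.ev_D.and h2).mono fun d hd => ?_
      have hdf : Dfb (Nice : Set ZFSet.{u} → Prop) (n := 3)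
          (fun _ v => ∀ z ∈ v 0, ¬ z ∈ v 1 → z ∈ v 2) := by
        repeat' first
          | apply Dfb.allB | apply Dfb.mem | apply Dfb.not | apply Dfb.imp
          | exact Tm.var ⟨_, fun _ => rfl⟩
      refine (c.j.tr3 (fun _ X Y Z => ∀ z ∈ X, ¬ z ∈ Y → z ∈ Z) hdf _ _ _).1 ?_ _
        (c.pair_mem_Q hd.1 (c.SK a ha)) hd.2
      intro z h1 h2
      rw [ZFSet.mem_sep] at h2 ⊢
      exact ⟨h1, fun h3 => h2 ⟨h1, h3⟩⟩

theorem al_iff (R : Set ZFSet.{u} → ZFSet.{u} → ZFSet.{u} → ZFSet.{u} → ZFSet.{u} → Prop)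
    (hR : Dfb Nice (n := 4) (fun C v => R C (v 0) (v 1) (v 2) (v 3))) (p q r : ZFSet.{u})
    {a : ZFSet.{u}} (ha : a ∈ c.S) :
    c.Al a (fun x => R Set.univ x p q r) ↔
      c.Ev (fun d => R M (ZFSet.pair d a) (c.j p) (c.j q) (c.j r)) := by
  constructor
  · intro h
    exact Ev.mono h fun d hd => ((c.j.sep_iff R hR c.Q p q r _).1 hd).2
  · intro h
    exact (c.ev_D.and h).mono fun d hd =>
      (c.j.sep_iff R hR c.Q p q r _).2 ⟨c.pair_mem_Q hd.1 (c.SK a ha), hd.2⟩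

noncomputable def p1 (x : ZFSet.{u}) : ZFSet.{u} := ZFSet.pair (fs x) (fs (sn x))
noncomputable def p2 (x : ZFSet.{u}) : ZFSet.{u} := ZFSet.pair (fs x) (sn (sn x))

theorem al_p1 {a b : ZFSet.{u}} (ha : a ∈ c.S) (hb : b ∈ c.S) {Y : ZFSet.{u} → Prop}
    (h : c.Al (ZFSet.pair a b) (fun x => Y (p1 x))) : c.Al a Y := by
  refine (c.ev_D.and h).mono fun d hd => ?_
  have hdf : Dfb (Nice : Set ZFSet.{u} → Prop) (n := 5)
      (fun _ v => ∀ b ∈ v 2, ZFSet.pair (v 0) (ZFSet.pair (v 1) b) ∈ v 3 → ZFSet.pair (v 0) (v 1) ∈ v 4) := by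
    repeat' first
      | apply Dfb.allB | apply Dfb.mem | apply Dfb.imp | apply Tm.pair
      | exact Tm.var ⟨_, fun _ => rfl⟩
  refine c.trDK (fun _ d a K Z Z' => ∀ b ∈ K, ZFSet.pair d (ZFSet.pair a b) ∈ Z → ZFSet.pair d a ∈ Z') hdf
    c.K (ZFSet.sep (fun x => Y (p1 x)) c.Q) (ZFSet.sep Y c.Q) ?_ d hd.1 a (c.SK a ha) b (c.SK b hb) hd.2
  intro d hd a ha b hb h
  rw [ZFSet.mem_sep] at h ⊢
  refine ⟨ZFSet.pair_mem_prod.2 ⟨hd, ha⟩, ?_⟩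
  have := h.2
  simpa [p1] using this

/-! Terms -/
abbrev Te : Type (u+1) := ZFSet.{u} × {a : ZFSet.{u} // a ∈ c.S}

noncomputable def val (t : c.Te) (d : ZFSet.{u}) : ZFSet.{u} := app (c.j t.1) (ZFSet.pair d t.2.1)
def E (s t : c.Te) : Prop := c.Ev (fun d => c.val s d ∈ c.val t d)
def Eqq (s t : c.Te) : Prop := c.Ev (fun d => c.val s d = c.val t d)

theorem Eqq.symm {c : Ctx M} {s t : c.Te} (h : c.Eqq s t) : c.Eqq t s := Ev.mono h fun _ h => h.symm
theorem E.cl {c : Ctx M} {s s' t : c.Te} (h : c.Eqq s s') (h' : c.E s t) : c.E s' t :=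
  (Ev.and h h').mono fun _ h => h.1 ▸ h.2
theorem E.cr {c : Ctx M} {s t t' : c.Te} (h : c.Eqq t t') (h' : c.E s t) : c.E s t' :=
  (Ev.and h h').mono fun _ h => h.1 ▸ h.2

theorem E_iff {F G : ZFSet.{u}} {a : {a : ZFSet.{u} // a ∈ c.S}} :
    c.E (F, a) (G, a) ↔ c.Al a.1 (fun x => app F x ∈ app G x) := by
  refine (c.al_iff (fun _ x F G _ => app F x ∈ app G x) ?_ F G ∅ a.2).symm
  apply Dfb.mem <;> apply Tm.app <;> exact Tm.var ⟨_, fun _ => rfl⟩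

theorem Eqq_iff {F G : ZFSet.{u}} {a : {a : ZFSet.{u} // a ∈ c.S}} :
    c.Eqq (F, a) (G, a) ↔ c.Al a.1 (fun x => app F x = app G x) := by
  refine (c.al_iff (fun _ x F G _ => app F x = app G x) ?_ F G ∅ a.2).symm
  apply Dfb.eq <;> apply Tm.app <;> exact Tm.var ⟨_, fun _ => rfl⟩

noncomputable def F1 (F : ZFSet.{u}) : ZFSet.{u} := WSC.mk c.Q (fun x => app F (p1 x))
noncomputable def F2 (F : ZFSet.{u}) : ZFSet.{u} := WSC.mk c.Q (fun x => app F (p2 x))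
def pr (a b : {a : ZFSet.{u} // a ∈ c.S}) : {a : ZFSet.{u} // a ∈ c.S} :=
  ⟨ZFSet.pair a.1 b.1, c.Spr _ a.2 _ b.2⟩

theorem Eqq_F1 (F : ZFSet.{u}) (a b : {a : ZFSet.{u} // a ∈ c.S}) : c.Eqq (c.F1 F, c.pr a b) (F, a) := by
  refine c.ev_of fun d hd => ?_
  have hdf : Dfb (Nice : Set ZFSet.{u} → Prop) (n := 5)
      (fun _ v => ∀ b ∈ v 2, app (v 3) (ZFSet.pair (v 0) (ZFSet.pair (v 1) b)) =
        app (v 4) (ZFSet.pair (v 0) (v 1))) := by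
    repeat' first
      | apply Dfb.allB | apply Dfb.eq | apply Tm.app | apply Tm.pair
      | exact Tm.var ⟨_, fun _ => rfl⟩
  refine c.trDK (fun _ d a K F' F => ∀ b ∈ K, app F' (ZFSet.pair d (ZFSet.pair a b)) =
    app F (ZFSet.pair d a)) hdf c.K (c.F1 F) F ?_ d hd a.1 (c.SK a.1 a.2) b.1 (c.SK b.1 b.2)
  intro d hd a ha b hb
  rw [F1, app_mk (c.mem_Q hd (c.K_pair ha hb))]
  simp [p1]

theorem Eqq_F2 (F : ZFSet.{u}) (a b : {a : ZFSet.{u} // a ∈ c.S}) : c.Eqq (c.F2 F, c.pr a b) (F, b) := by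
  refine c.ev_of fun d hd => ?_
  have hdf : Dfb (Nice : Set ZFSet.{u} → Prop) (n := 5)
      (fun _ v => ∀ b ∈ v 2, app (v 3) (ZFSet.pair (v 0) (ZFSet.pair (v 1) b)) =
        app (v 4) (ZFSet.pair (v 0) b)) := by
    repeat' first
      | apply Dfb.allB | apply Dfb.eq | apply Tm.app | apply Tm.pair
      | exact Tm.var ⟨_, fun _ => rfl⟩
  refine c.trDK (fun _ d a K F' F => ∀ b ∈ K, app F' (ZFSet.pair d (ZFSet.pair a b)) =
    app F (ZFSet.pair d b)) hdf c.K (c.F2 F) F ?_ d hd a.1 (c.SK a.1 a.2) b.1 (c.SK b.1 b.2)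
  intro d hd a ha b hb
  rw [F2, app_mk (c.mem_Q hd (c.K_pair ha hb))]
  simp [p2]

theorem E_wf : WellFounded c.E := by
  rw [wellFounded_iff_isEmpty_descending_chain]
  refine ⟨fun ⟨t, ht⟩ => ?_⟩
  let Sg : ZFSet.{u} := ZFSet.range (fun n : ℕ => (t n).1)
  obtain ⟨r, _, hr⟩ := c.good.2.2.2.2.2.2.2.2.2 (c.j Sg) (c.j.mem_M _)
  have hSg : ∀ n, c.j (t n).1 ∈ c.j Sg := fun n => c.j.mem_iff.2 (ZFSet.mem_range.2 ⟨n, rfl⟩)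
  have key : ∀ n, app r (ZFSet.pair (c.j (t (n+1)).1) (t (n+1)).2.1) ∈ app r (ZFSet.pair (c.j (t n).1) (t n).2.1) := by
    intro n
    obtain ⟨X, hX, h⟩ := ht n
    exact hr _ (hSg _) _ (hSg _) _ (t (n+1)).2.2 _ (t n).2.2 X hX h
  have hwf : WellFounded (fun x y : ZFSet.{u} => x ∈ y) := ZFSet.mem_wf
  rw [wellFounded_iff_isEmpty_descending_chain] at hwf
  exact hwf.false ⟨fun n => app r (ZFSet.pair (c.j (t n).1) (t n).2.1), key⟩

theorem E_ext (s t : c.Te) (h : ∀ r, c.E r s ↔ c.E r t) : c.Eqq s t := by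
  obtain ⟨F, a⟩ := s
  obtain ⟨G, b⟩ := t
  have e1 := c.Eqq_F1 F a b
  have e2 := c.Eqq_F2 G a b
  suffices hs : c.Eqq (c.F1 F, c.pr a b) (c.F2 G, c.pr a b) by
    exact (Ev.and e1 (Ev.and e2 hs)).mono fun d hd => hd.1.symm.trans (hd.2.2.trans hd.2.1)
  have h' : ∀ r, c.E r (c.F1 F, c.pr a b) ↔ c.E r (c.F2 G, c.pr a b) := fun r =>
    ⟨fun hr => E.cr e2.symm ((h r).1 (E.cr e1 hr)), fun hr => E.cr e1.symm ((h r).2 (E.cr e2 hr))⟩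
  by_contra hne
  rw [Eqq_iff, ← c.al_not (c.pr a b).2] at hne
  generalize c.F1 F = F' at *
  generalize c.F2 G = G' at *
  have hsk : ∀ x : ZFSet.{u}, ∃ y, app F' x ≠ app G' x → ¬ (y ∈ app F' x ↔ y ∈ app G' x) := by
    intro x
    by_cases hx : app F' x = app G' x
    · exact ⟨∅, fun h => absurd hx h⟩
    · have : ∃ y, ¬ (y ∈ app F' x ↔ y ∈ app G' x) := by
        by_contra hh
        push Not at hh
        exact hx (ZFSet.ext hh)
      exact this.imp fun y hy _ => hy
  choose y hy using hsk
  have hH := h' (WSC.mk c.Q y, c.pr a b)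
  rw [E_iff, E_iff] at hH
  by_cases h1 : c.Al (c.pr a b).1 (fun x => app (WSC.mk c.Q y) x ∈ app F' x)
  · obtain ⟨x, hx, h2, h3, h4⟩ := (hne.and (h1.and (hH.1 h1))).ex
    rw [app_mk hx] at h3 h4
    exact hy x h2 ⟨fun _ => h4, fun _ => h3⟩
  · have h2 : ¬ c.Al (c.pr a b).1 (fun x => app (WSC.mk c.Q y) x ∈ app G' x) := fun hh => h1 (hH.2 hh)
    rw [← c.al_not (c.pr a b).2] at h1 h2
    obtain ⟨x, hx, h2, h3, h4⟩ := (hne.and (h1.and h2)).ex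
    rw [app_mk hx] at h3 h4
    exact hy x h2 ⟨fun h => absurd h h3, fun h => absurd h h4⟩

theorem E_small (t : c.Te) : ∃ D : Set c.Te, Small.{u} D ∧ (∀ r ∈ D, c.E r t) ∧
    ∀ r, c.E r t → ∃ r' ∈ D, c.Eqq r r' := by
  classical
  obtain ⟨F, a⟩ := t
  let W := ZFSet.sUnion (ZFSet.sUnion F)
  let P := ZFSet.powerset (ZFSet.prod c.Q (ZFSet.sUnion W))
  refine ⟨{r | c.E r (F, a) ∧ r.1 ∈ P}, ?_, fun r hr => hr.1, ?_⟩
  · let f : {r : c.Te | c.E r (F, a) ∧ r.1 ∈ P} → {x // x ∈ P} × {a // a ∈ c.S} :=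
      fun r => (⟨r.1.1, r.2.2⟩, r.1.2)
    refine small_of_injective (f := f) ?_
    rintro ⟨⟨G, b⟩, h⟩ ⟨⟨G', b'⟩, h'⟩ hh
    simp only [f, Prod.mk.injEq, Subtype.mk.injEq] at hh
    obtain ⟨rfl, rfl⟩ := hh
    rfl
  · rintro ⟨G, b⟩ hr
    let G' := WSC.mk c.Q (fun x => if app G x ∈ W then app G x else ∅)
    have hq : c.Eqq (G, b) (G', b) := by
      refine (c.ev_D.and hr).mono fun d hd => ?_
      have hdf : Dfb (Nice : Set ZFSet.{u} → Prop) (n := 5)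
        (fun C v => ∀ y ∈ C, app (v 2) (ZFSet.pair (v 0) (v 1)) ∈ app (v 4) y →
          app (v 2) (ZFSet.pair (v 0) (v 1)) = app (v 3) (ZFSet.pair (v 0) (v 1))) := by
        repeat' first
          | apply Dfb.allC | apply Dfb.mem | apply Dfb.eq | apply Dfb.imp | apply Tm.app | apply Tm.pair
          | exact Tm.var ⟨_, fun _ => rfl⟩
      refine c.trDK (fun C d b G G' F => ∀ y ∈ C, app G (ZFSet.pair d b) ∈ app F y →
        app G (ZFSet.pair d b) = app G' (ZFSet.pair d b)) hdf G G' F ?_ d hd.1 b.1 (c.SK _ b.2)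
        (ZFSet.pair d a.1) ?_ hd.2
      · intro d hd b hb y _ h
        rw [show app G' (ZFSet.pair d b) = _ from app_mk (c.mem_Q hd hb), if_pos]
        exact (ZFSet.mem_sep.1 h).1
      · exact c.j.trM _ (c.j.mem_M _) _ (c.pair_mem_Q hd.1 (c.SK _ a.2))
    refine ⟨(G', b), ⟨E.cl hq hr, ?_⟩, hq⟩
    show G' ∈ P
    rw [ZFSet.mem_powerset]
    intro p hp
    obtain ⟨x, hx, z, hz, rfl⟩ := mem_mk.1 hp
    refine ZFSet.pair_mem_prod.2 ⟨hx, ?_⟩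
    split_ifs at hz with hW
    · exact ZFSet.mem_sUnion.2 ⟨_, hW, hz⟩
    · exact absurd hz (ZFSet.notMem_empty _)

theorem collapse : ∃ π : c.Te → ZFSet.{u}, (∀ s t, π s = π t ↔ c.Eqq s t) ∧
    (∀ s t, π s ∈ π t ↔ c.E s t) ∧ ∀ t x, x ∈ π t → ∃ s, π s = x :=
  mostowski c.E c.Eqq c.E_wf (fun _ _ h => h.symm) (fun _ _ _ h h' => E.cl h h')
    (fun _ _ _ h h' => E.cr h h') c.E_ext c.E_small

end Ctx

/-! ### Cardinality, in a form that can be transferred -/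
def CLt (C : Set ZFSet.{u}) (s t : ZFSet.{u}) : Prop :=
  ∃ β ∈ t, ∃ f ∈ C, (∀ p ∈ f, ∃ a ∈ s, ∃ b ∈ C, p = ZFSet.pair a b) ∧
    (∀ a ∈ s, ∃ b ∈ C, ZFSet.pair a b ∈ f ∧ ∀ b' ∈ C, ZFSet.pair a b' ∈ f → b' = b) ∧
    (∀ x ∈ C, ∀ y ∈ C, ZFSet.pair x y ∈ f → y ∈ β) ∧
    (∀ x ∈ C, ∀ x' ∈ C, ∀ y ∈ C, ZFSet.pair x y ∈ f → ZFSet.pair x' y ∈ f → x = x')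

theorem dfb_clt : Dfb (Nice : Set ZFSet.{u} → Prop) (n := 2) (fun C v => CLt C (v 0) (v 1)) := by
  unfold CLt
  repeat' first
    | apply Dfb.and | apply Dfb.exC | apply Dfb.allC | apply Dfb.allB | apply Dfb.exB
    | apply Dfb.mem | apply Dfb.eq | apply Dfb.imp | apply Tm.pair
    | exact Tm.var ⟨_, fun _ => rfl⟩

theorem pair_mem_class {C : Set ZFSet.{u}} (hC : TransClass C) {f x y : ZFSet.{u}} (hf : f ∈ C)
    (h : ZFSet.pair x y ∈ f) : x ∈ C ∧ y ∈ C := by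
  have h1 := hC _ hf _ h
  have h2 : ({x, y} : ZFSet.{u}) ∈ C := hC _ h1 _ (by simp [ZFSet.pair])
  exact ⟨hC _ h2 _ (by simp), hC _ h2 _ (by simp)⟩

theorem CLt.card {C : Set ZFSet.{u}} (hC : TransClass C) {s t : ZFSet.{u}}
    (h : CLt C s t) : CardLtIn C s t := by
  obtain ⟨β, hβ, f, hf, h1, h2, h3, h4⟩ := h
  refine ⟨β, f, hβ, hf, ⟨?_, ?_⟩, ?_, ?_⟩
  · intro p hp
    obtain ⟨a, ha, b, _, rfl⟩ := h1 p hp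
    exact ⟨a, b, ha, rfl⟩
  · intro a ha
    obtain ⟨b, _, hb, hu⟩ := h2 a ha
    exact ⟨b, hb, fun b' hb' => hu b' (pair_mem_class hC hf hb').2 hb'⟩
  · intro x y hxy
    have := pair_mem_class hC hf hxy
    exact h3 x this.1 y this.2 hxy
  · intro x x' y hxy hxy'
    have := pair_mem_class hC hf hxy
    exact h4 x this.1 x' (pair_mem_class hC hf hxy').1 y this.2 hxy hxy'

theorem CLt.of_card {s t : ZFSet.{u}} (h : CardLtIn Set.univ s t) : CLt Set.univ s t := by
  obtain ⟨β, f, hβ, hf, ⟨h1, h2⟩, h3, h4⟩ := h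
  refine ⟨β, hβ, f, hf, ?_, ?_, ?_, ?_⟩
  · intro p hp
    obtain ⟨a, b, ha, rfl⟩ := h1 p hp
    exact ⟨a, ha, b, trivial, rfl⟩
  · intro a ha
    obtain ⟨b, hb, hu⟩ := h2 a ha
    exact ⟨b, trivial, hb, fun b' _ hb' => hu b' hb'⟩
  · intro x _ y _ hxy
    exact h3 x y hxy
  · intro x _ x' _ y _ hxy hxy'
    exact h4 x x' y hxy hxy'

theorem Lg.cardLt_img {κ d : ZFSet.{u}} (h : Lg κ) (hd : CardLtIn Set.univ d κ) (g : ZFSet.{u} → ZFSet.{u}) :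
    CardLtIn Set.univ (img d g) κ := by
  classical
  obtain ⟨β, f, hβ, -, ⟨h1, h2⟩, h3, h4⟩ := hd
  refine h.cardLt (T := β) (ZFSet.rank_lt_of_mem hβ)
    (fun t => if hq : ∃ q, ZFSet.pair q t ∈ f then g hq.choose else ∅) ?_
  intro x hx
  obtain ⟨q, hq, rfl⟩ := mem_img.1 hx
  obtain ⟨t, ht, -⟩ := h2 q hq
  have hex : ∃ q, ZFSet.pair q t ∈ f := ⟨q, ht⟩
  refine ⟨t, h3 _ _ ht, ?_⟩
  rw [dif_pos hex, h4 _ _ _ hex.choose_spec ht]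

/-- The transitive collapse of the ultrapower. -/
structure Cl {M : Set ZFSet.{u}} (c : Ctx M) where
  π : c.Te → ZFSet.{u}
  heq : ∀ s t, π s = π t ↔ c.Eqq s t
  hmem : ∀ s t, π s ∈ π t ↔ c.E s t
  hsurj : ∀ t x, x ∈ π t → ∃ s, π s = x

namespace Cl
variable {M : Set ZFSet.{u}} {c : Ctx M} (e : Cl c)

def N : Set ZFSet.{u} := Set.range e.π

theorem trN : TransClass e.N := by
  rintro _ ⟨t, rfl⟩ y hy
  exact e.hsurj t y hy

theorem los {n : ℕ} (φ : Fml n) : ∀ (F : Fin n → ZFSet.{u}) (a : {a : ZFSet.{u} // a ∈ c.S}),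
    (Fml.Realize e.N φ (fun i => e.π (F i, a)) ↔
      c.Al a.1 (fun x => Fml.Realize Set.univ φ (fun i => app (F i) x))) := by
  induction φ with
  | mem i j => intro F a; simp only [Fml.Realize]; rw [e.hmem, c.E_iff]
  | eq i j => intro F a; simp only [Fml.Realize]; rw [e.heq, c.Eqq_iff]
  | not φ ih => intro F a; simp only [Fml.Realize]; rw [ih, c.al_not a.2]
  | and φ ψ ih ih' =>
    intro F a
    simp only [Fml.Realize]
    rw [ih, ih']
    exact ⟨fun h => h.1.and h.2, fun h => ⟨h.mono fun _ _ h => h.1, h.mono fun _ _ h => h.2⟩⟩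
  | @ex n φ ih =>
    intro F a
    simp only [Fml.Realize]
    constructor
    · rintro ⟨_, ⟨⟨G, b⟩, rfl⟩, h⟩
      have hv : (Fin.snoc (fun i => e.π (F i, a)) (e.π (G, b)) : Fin (n+1) → ZFSet.{u}) =
          fun i => e.π ((Fin.snoc (fun i => c.F1 (F i)) (c.F2 G) : Fin (n+1) → ZFSet.{u}) i, c.pr a b) := by
        funext i
        refine Fin.lastCases ?_ (fun i => ?_) i
        · simp only [Fin.snoc_last]
          exact ((e.heq _ _).2 (c.Eqq_F2 G a b)).symm
        · simp only [Fin.snoc_castSucc]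
          exact ((e.heq _ _).2 (c.Eqq_F1 (F i) a b)).symm
      rw [hv, ih] at h
      refine c.al_p1 a.2 b.2 (h.mono fun x hx hh => ⟨app G (Ctx.p2 x), trivial, ?_⟩)
      convert hh using 1
      funext i
      refine Fin.lastCases ?_ (fun i => ?_) i
      · simp only [Fin.snoc_last]
        rw [Ctx.F2, app_mk hx]
      · simp only [Fin.snoc_castSucc]
        rw [Ctx.F1, app_mk hx]
    · intro h
      have hsk : ∀ x : ZFSet.{u}, ∃ y, (∃ y ∈ (Set.univ : Set ZFSet.{u}),
          Fml.Realize Set.univ φ (Fin.snoc (fun i => app (F i) x) y)) →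
          Fml.Realize Set.univ φ (Fin.snoc (fun i => app (F i) x) y) := by
        intro x
        by_cases hx : ∃ y ∈ (Set.univ : Set ZFSet.{u}),
          Fml.Realize Set.univ φ (Fin.snoc (fun i => app (F i) x) y)
        · obtain ⟨y, _, hy⟩ := hx
          exact ⟨y, fun _ => hy⟩
        · exact ⟨∅, fun h => absurd h hx⟩
      choose y hy using hsk
      refine ⟨e.π (WSC.mk c.Q y, a), ⟨_, rfl⟩, ?_⟩
      have hv : (Fin.snoc (fun i => e.π (F i, a)) (e.π (WSC.mk c.Q y, a)) : Fin (n+1) → ZFSet.{u}) =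
          fun i => e.π ((Fin.snoc F (WSC.mk c.Q y) : Fin (n+1) → ZFSet.{u}) i, a) := by
        funext i
        refine Fin.lastCases ?_ (fun i => ?_) i
        · simp only [Fin.snoc_last]
        · simp only [Fin.snoc_castSucc]
      rw [hv, ih]
      refine h.mono fun x hx hh => ?_
      convert hy x hh using 1
      funext i
      refine Fin.lastCases ?_ (fun i => ?_) i
      · simp only [Fin.snoc_last]
        exact app_mk hx
      · simp only [Fin.snoc_castSucc]

end Cl

namespace Ctx
variable {M : Set ZFSet.{u}} (c : Ctx M)

noncomputable def cn (x : ZFSet.{u}) : ZFSet.{u} := WSC.mk c.Q (fun _ => x)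
noncomputable def si : ZFSet.{u} := WSC.mk c.Q sn
def a0 : {a : ZFSet.{u} // a ∈ c.S} := ⟨c.L, c.hLS⟩

theorem val_cn (x : ZFSet.{u}) (a : {a : ZFSet.{u} // a ∈ c.S}) {d : ZFSet.{u}} (hd : d ∈ c.j c.D) :
    c.val (c.cn x, a) d = c.j x := by
  refine c.trDK (fun _ d a p q _ => app p (ZFSet.pair d a) = q) ?_ (c.cn x) x ∅ ?_ d hd a.1 (c.SK _ a.2)
  · repeat' first
      | apply Dfb.eq | apply Tm.app | apply Tm.pair | exact Tm.var ⟨_, fun _ => rfl⟩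
  · intro d hd a ha
    exact app_mk (c.mem_Q hd ha)

theorem val_si (a : {a : ZFSet.{u} // a ∈ c.S}) {d : ZFSet.{u}} (hd : d ∈ c.j c.D) :
    c.val (c.si, a) d = a.1 := by
  refine c.trDK (fun _ d a p _ _ => app p (ZFSet.pair d a) = a) ?_ c.si ∅ ∅ ?_ d hd a.1 (c.SK _ a.2)
  · repeat' first
      | apply Dfb.eq | apply Tm.app | apply Tm.pair | exact Tm.var ⟨_, fun _ => rfl⟩
  · intro d hd a ha
    exact (app_mk (c.mem_Q hd ha)).trans (sn_pair _ _)

end Ctx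

namespace Cl
variable {M : Set ZFSet.{u}} {c : Ctx M} (e : Cl c)

noncomputable def i (x : ZFSet.{u}) : ZFSet.{u} := e.π (c.cn x, c.a0)

theorem i_elem {n : ℕ} (φ : Fml n) (v : Fin n → ZFSet.{u}) :
    (Fml.Realize Set.univ φ v ↔ Fml.Realize e.N φ (fun k => e.i (v k))) := by
  have h := e.los φ (fun k => c.cn (v k)) c.a0
  have h2 : ∀ x ∈ c.Q, (fun k => app (c.cn (v k)) x) = v := fun x hx => funext fun k => app_mk hx
  refine Iff.trans ?_ h.symm
  constructor
  · intro hh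
    refine c.al_of c.a0.2 fun x hx => ?_
    rw [h2 x hx]; exact hh
  · intro hh
    obtain ⟨x, hx, hh⟩ := hh.ex
    rw [h2 x hx] at hh; exact hh

noncomputable def emb : ElemEmb.{u,u} Set.univ e.N where
  toFun := e.i
  maps := fun _ _ => ⟨_, rfl⟩
  elem := fun φ v _ => e.i_elem φ v

theorem niceN : Nice e.N := nice_of_emb e.trN e.emb

theorem i_eq (x : ZFSet.{u}) (a : {a : ZFSet.{u} // a ∈ c.S}) : e.i x = e.π (c.cn x, a) :=
  (e.heq _ _).2 (c.ev_of fun _ hd => (c.val_cn x _ hd).trans (c.val_cn x a hd).symm)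

theorem si_eq : ∀ (x : ZFSet.{u}) (hx : x ∈ c.S), e.π (c.si, ⟨x, hx⟩) = x := by
  intro x
  induction x using ZFSet.inductionOn with
  | _ x ih =>
  intro hx
  ext z
  constructor
  · intro hz
    obtain ⟨⟨G, b⟩, rfl⟩ := e.hsurj _ _ hz
    rw [e.hmem] at hz
    obtain ⟨X, hX, h⟩ := (c.ev_D.and hz)
    obtain ⟨x', hx', Y, hY, h'⟩ := c.good.2.2.2.2.2.2.2.2.1 (c.j G) (c.j.mem_M _) b.1 b.2 x hx X hX (by
      intro d hd
      have h5 := (h d hd).2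
      rw [c.val_si _ (h d hd).1] at h5
      exact h5)
    have hx'S := c.Str x hx x' hx'
    have hq : c.Eqq (G, b) (c.si, ⟨x', hx'S⟩) := by
      have h2 : c.Ev (fun d => app (c.j G) (ZFSet.pair d b.1) = x') := ⟨Y, hY, h'⟩
      exact (c.ev_D.and h2).mono fun d hd => hd.2.trans (c.val_si ⟨x', hx'S⟩ hd.1).symm
    rw [(e.heq _ _).2 hq, ih x' hx' hx'S]
    exact hx'
  · intro hz
    have hzS := c.Str x hx z hz
    rw [← ih z hz hzS, e.hmem]
    refine c.ev_of fun d hd => ?_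
    rw [c.val_si _ hd, c.val_si _ hd]
    exact hz

theorem mem_i {x B : ZFSet.{u}} (hx : x ∈ c.S) : x ∈ e.i B ↔ x ∈ c.j B := by
  have h : x ∈ e.i B ↔ c.E (c.si, ⟨x, hx⟩) (c.cn B, c.a0) := by
    rw [← e.hmem, e.si_eq]; rfl
  rw [h]
  constructor
  · intro h
    obtain ⟨d, hd, h⟩ := h.ex
    rwa [c.val_si _ hd, c.val_cn _ _ hd] at h
  · intro h
    refine c.ev_of fun d hd => ?_
    rwa [c.val_si _ hd, c.val_cn _ _ hd]

theorem i_fix {x : ZFSet.{u}} (hx : x ∈ c.S) (h : c.j x = x) : e.i x = x := by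
  rw [e.i_eq x ⟨x, hx⟩]
  conv_rhs => rw [← e.si_eq x hx]
  refine (e.heq _ _).2 (c.ev_of fun d hd => ?_)
  rw [c.val_si _ hd, c.val_cn _ _ hd, h]

theorem covers : CoversIn Set.univ e.N e.i c.κ c.L := by
  rintro X - hXN ⟨f, -, ⟨hf1, hf2⟩, hf3, hf4⟩
  have hT : ∀ ξ : ZFSet.{u}, ∃ t : c.Te, ∀ x ∈ X, ZFSet.pair x ξ ∈ f → e.π t = x := by
    intro ξ
    by_cases hx : ∃ x ∈ X, ZFSet.pair x ξ ∈ f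
    · obtain ⟨x, hx, h⟩ := hx
      obtain ⟨t, ht⟩ := hXN hx
      exact ⟨t, fun x' _ h' => ht.trans (hf4 _ _ _ h h')⟩
    · exact ⟨(∅, c.a0), fun x hx' h => absurd ⟨x, hx', h⟩ hx⟩
  choose T hT using hT
  let σ : ZFSet.{u} → ZFSet.{u} := fun x => img (fs x) (fun q => app (T (fs q)).1 (ZFSet.pair (fs x) (sn q)))
  refine ⟨e.π (WSC.mk c.Q σ, c.a0), ⟨_, rfl⟩, ?_, ?_⟩
  · intro x hx
    obtain ⟨ξ, hξ, -⟩ := hf2 x hx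
    have hξL := hf3 _ _ hξ
    rw [← hT ξ x hx hξ, e.hmem]
    obtain ⟨Y, hY, hfine⟩ := c.good.2.2.2.2.2.2.2.1 (c.j ξ) (c.j.mem_iff.2 hξL) (T ξ).2.1 (T ξ).2.2
    have h2 : c.Ev (fun d => ZFSet.pair (c.j ξ) (T ξ).2.1 ∈ d) := ⟨Y, hY, hfine⟩
    refine (c.ev_D.and h2).mono fun d hd => ?_
    have hdf : Dfb (Nice : Set ZFSet.{u} → Prop) (n := 5) (fun _ v => ∀ d ∈ v 0, ∀ a ∈ v 1, ∀ b ∈ v 1,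
        ZFSet.pair (v 2) b ∈ d → app (v 3) (ZFSet.pair d b) ∈ app (v 4) (ZFSet.pair d a)) := by
      repeat' first
        | apply Dfb.allB | apply Dfb.mem | apply Dfb.imp | apply Tm.app | apply Tm.pair
        | exact Tm.var ⟨_, fun _ => rfl⟩
    refine (c.j.tr5 (fun _ D K ξ F s => ∀ d ∈ D, ∀ a ∈ K, ∀ b ∈ K,
        ZFSet.pair ξ b ∈ d → app F (ZFSet.pair d b) ∈ app s (ZFSet.pair d a)) hdf
        c.D c.K ξ (T ξ).1 (WSC.mk c.Q σ)).1 ?_ d hd.1 _ (c.SK _ c.a0.2) _ (c.SK _ (T ξ).2.2) hd.2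
    intro d hd a ha b hb h
    rw [app_mk (c.mem_Q hd ha)]
    refine mem_img.2 ⟨ZFSet.pair ξ b, by simpa using h, by simp⟩
  · apply CLt.card e.trN
    obtain ⟨φ, hφ⟩ := (dfb_clt : Dfb (Nice : Set ZFSet.{u} → Prop) _)
    refine (hφ e.N e.niceN ![e.π (WSC.mk c.Q σ, c.a0), e.i c.κ] ?_).1 ?_
    · intro k
      fin_cases k
      · exact ⟨_, rfl⟩
      · exact ⟨_, rfl⟩
    · have hv : ![e.π (WSC.mk c.Q σ, c.a0), e.i c.κ] = fun k => e.π (![WSC.mk c.Q σ, c.cn c.κ] k, c.a0) := by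
        funext k; fin_cases k <;> rfl
      rw [hv, e.los]
      refine c.al_of c.a0.2 fun x hx => ?_
      refine (hφ Set.univ nice_univ _ (fun _ => trivial)).2 ?_
      show CLt Set.univ (app (WSC.mk c.Q σ) x) (app (c.cn c.κ) x)
      rw [app_mk hx, Ctx.cn, app_mk hx]
      apply CLt.of_card
      refine c.lg.cardLt_img ?_ _
      obtain ⟨d, hd, a, ha, rfl⟩ := ZFSet.mem_prod.1 hx
      rw [fs_pair]
      exact (mem_DD.1 hd).2

end Cl

theorem Ctx.main {M : Set ZFSet.{u}} (c : Ctx M) (hκL : oLe c.κ c.L) (hL : c.L ∈ c.j c.κ) {A : ZFSet.{u}}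
    (hA : ∀ ξ ∈ c.L, (ξ ∈ A ↔ ξ ∈ c.j A)) : LamSCForIn Set.univ c.κ c.L A := by
  obtain ⟨π, h1, h2, h3⟩ := c.collapse
  let e : Cl c := ⟨π, h1, h2, h3⟩
  have hκS : ∀ α ∈ c.κ, α ∈ c.S := by
    intro α hα
    rcases hκL with h | h
    · exact c.Str _ (c.Str _ c.hLS _ h) _ hα
    · exact c.Str _ c.hLS _ (h ▸ hα)
  have hLi : c.L ∈ e.i c.κ := (e.mem_i c.hLS).2 hL
  refine ⟨e.N, fun _ _ => trivial, e.trN, e.emb, ⟨c.crit.1, ?_, ?_⟩, hLi, e.covers, ?_⟩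
  · intro h
    have h' : c.L ∈ c.κ := by
      have : e.i c.κ = c.κ := h
      rwa [this] at hLi
    rcases hκL with hh | hh
    · exact ZFSet.mem_asymm h' hh
    · rw [hh] at h'; exact ZFSet.mem_irrefl _ h'
  · intro α hα
    exact e.i_fix (hκS α hα) (c.crit.2.2 α hα)
  · intro ξ hξ
    rw [hA ξ hξ]
    exact (e.mem_i (c.Str _ c.hLS _ hξ)).symm

theorem pair_not_ord (μ : ZFSet.{u}) : ¬ IsOrd (ZFSet.pair μ μ) := by
  intro h
  have h1 : ({μ} : ZFSet.{u}) ∈ ZFSet.pair μ μ := by simp [ZFSet.pair]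
  have h2 : μ ∈ ZFSet.pair μ μ := h.trans h1 (ZFSet.mem_singleton.2 rfl)
  have h3 : μ ∈ μ := by
    have h4 : μ = {μ} := by simpa [ZFSet.pair] using h2
    have h5 : μ ∈ ({μ} : ZFSet.{u}) := ZFSet.mem_singleton.2 rfl
    rwa [← h4] at h5
  exact ZFSet.mem_irrefl _ h3

theorem main_aux (δ : ZFSet.{u}) (hW : Woodin δ)
    (hsc : ∀ α ∈ δ, ∃ κ : ZFSet.{u}, α ∈ κ ∧ κ ∈ δ ∧ LtSupercompact κ δ) :
    WoodinSC δ := by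
  refine ⟨hW.1, fun A _ hA => ?_⟩
  have hδ : IsOrd δ := hW.1.1
  have hsucc : ∀ {o : Ordinal.{u}}, o < δ.rank → Order.succ o < δ.rank := by
    intro o ho
    obtain ⟨β, h1, hβ, -⟩ := hsc _ (hδ.mem_of_rank ho)
    have := ZFSet.rank_lt_of_mem h1
    rw [Ordinal.rank_toZFSet] at this
    exact (Order.succ_le_of_lt this).trans_lt (ZFSet.rank_lt_of_mem hβ)
  have hpr : ∀ μ ∈ δ, (ZFSet.pair μ μ).rank < δ.rank := by
    intro μ hμ
    have h1 := hsucc (ZFSet.rank_lt_of_mem hμ)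
    simp only [ZFSet.pair, ZFSet.rank_pair, ZFSet.rank_singleton]
    exact max_lt (hsucc h1) (hsucc (max_lt h1 h1))
  let B := ZFSet.sep (fun μ => LtSupercompact μ δ) δ
  let A' := A ∪ img B (fun μ => ZFSet.pair μ μ)
  have hA' : ∀ x, x ∈ A' ↔ x ∈ A ∨ ∃ μ ∈ δ, LtSupercompact μ δ ∧ ZFSet.pair μ μ = x := by
    intro x
    simp only [A', B, ZFSet.mem_union, mem_img, ZFSet.mem_sep, and_assoc]
  have hagree : ∀ ξ ∈ δ, (ξ ∈ A ↔ ξ ∈ A') := by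
    intro ξ hξ
    rw [hA']
    refine ⟨Or.inl, ?_⟩
    rintro (h | ⟨μ, _, _, rfl⟩)
    · exact h
    · exact absurd (hδ.mem hξ) (pair_not_ord μ)
  have hsub : SubV A' δ := by
    intro x hx
    rcases (hA' x).1 hx with h | ⟨μ, hμ, -, rfl⟩
    · exact ZFSet.rank_lt_of_mem (hA h)
    · exact hpr μ hμ
  obtain ⟨κ, hκδ, hκ⟩ := hW.2 A' trivial hsub
  have hκo := hδ.mem hκδ
  refine ⟨κ, hκδ, fun L hκL hLδ => ?_⟩
  have hlim : ∀ α ∈ κ, ∃ μ ∈ κ, α ∈ μ ∧ LamSupercompact μ L := by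
    intro α hα
    obtain ⟨μ, hκμ, hμδ, hμ⟩ := hsc κ hκδ
    have hr := hsucc (hpr μ hμδ)
    set L1 := (Order.succ (ZFSet.pair μ μ).rank).toZFSet with hL1
    have hL1δ : L1 ∈ δ := hδ.mem_of_rank hr
    have hL1r : L1.rank = Order.succ (ZFSet.pair μ μ).rank := Ordinal.rank_toZFSet _
    have hL1o := hδ.mem hL1δ
    have hμp : μ.rank < (ZFSet.pair μ μ).rank := by
      have e1 : μ ∈ ({μ} : ZFSet.{u}) := ZFSet.mem_singleton.2 rfl
      have e2 : ({μ} : ZFSet.{u}) ∈ ZFSet.pair μ μ := by simp [ZFSet.pair]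
      exact (ZFSet.rank_lt_of_mem e1).trans (ZFSet.rank_lt_of_mem e2)
    have hpL : (ZFSet.pair μ μ).rank < L1.rank := by rw [hL1r]; exact Order.lt_succ _
    have hμL1 : μ ∈ L1 := ((hδ.mem hμδ).rank_lt hL1o).1 (hμp.trans hpL)
    have hκL1 : κ ∈ L1 := hL1o.trans hμL1 hκμ
    obtain ⟨M, -, hM, k, hcrit, hL1k, -, hag⟩ := hκ L1 (Or.inl hκL1) hL1δ
    let j : VEmb M := { k with trM := hM }
    have hjκ : IsOrd (j κ) := j.isOrd hκo
    have hdf : Dfb (Nice : Set ZFSet.{u} → Prop) (n := 3)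
        (fun _ v => ∃ μ ∈ v 0, v 1 ∈ μ ∧ ZFSet.pair μ μ ∈ v 2) := by
      repeat' first
        | apply Dfb.exB | apply Dfb.and | apply Dfb.mem | apply Tm.pair
        | exact Tm.var ⟨_, fun _ => rfl⟩
    have hjα : j α = α := hcrit.2.2 α hα
    obtain ⟨ν, hν, hαν, hνA⟩ := (j.tr3 (fun _ κ α A' => ∃ μ ∈ κ, α ∈ μ ∧ ZFSet.pair μ μ ∈ A') hdf κ α A').2 (by
      refine ⟨μ, hjκ.trans hL1k hμL1, ?_, ?_⟩
      · rw [hjα]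
        exact (hδ.mem hμδ).trans hκμ hα
      · exact (hag _ trivial hpL).1 ((hA' _).2 (Or.inr ⟨μ, hμδ, hμ, rfl⟩)))
    refine ⟨ν, hν, hαν, ?_⟩
    rcases (hA' _).1 hνA with h | ⟨μ', _, hμ', he⟩
    · exact absurd (hδ.mem (hA h)) (pair_not_ord ν)
    · obtain ⟨rfl, -⟩ := ZFSet.pair_inj.1 he
      refine hμ' L (Or.inl ?_) hLδ
      rcases hκL with h | h
      · exact (hδ.mem hLδ).trans h hν
      · exact h ▸ hν
  obtain ⟨M, -, hM, k, hcrit, hLk, -, hag⟩ := hκ L hκL hLδ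
  let j : VEmb M := { k with trM := hM }
  have hcr : IsCrit j.toElemEmb κ := hcrit
  have hphi := (j.tr3 _ dfb_phi (DD κ L) (KK κ) L).1 (phi_V (j.lg hcr) hlim)
  have hLK : L ∈ j (KK κ) :=
    j.subset (x := κ) (fun α hα => mem_KK.2 (ZFSet.rank_lt_of_mem hα)) hLk
  obtain ⟨S, -, U, -, hLS, hgood⟩ := hphi L hLK
  let c : Ctx M := { j := j, κ := κ, L := L, S := S, U := U, crit := hcr, good := hgood, hLS := hLS }
  refine c.main hκL hLk ?_
  intro ξ hξ
  have hξj : ξ ∈ j δ := (j.isOrd hδ).trans (j.mem_iff.2 hκδ) ((j.isOrd hκo).trans hLk hξ)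
  have hdf : Dfb (Nice : Set ZFSet.{u} → Prop) (n := 3)
      (fun _ v => ∀ ξ ∈ v 0, (ξ ∈ v 1 ↔ ξ ∈ v 2)) := by
    repeat' first
      | apply Dfb.allB | apply Dfb.iff | apply Dfb.mem
      | exact Tm.var ⟨_, fun _ => rfl⟩
  have h1 := (j.tr3 (fun _ δ A A' => ∀ ξ ∈ δ, (ξ ∈ A ↔ ξ ∈ A')) hdf δ A A').1 hagree ξ hξj
  have h2 := hag ξ trivial (ZFSet.rank_lt_of_mem hξ)
  have h3 := hagree ξ (hδ.trans hLδ hξ)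
  exact h3.trans (h2.trans h1.symm)

/-- **Proposition.**  If `δ` is Woodin and there are unboundedly many
`<δ`-supercompact cardinals below `δ`, then `δ` is Woodin for strong
compactness. -/
theorem woodin_limit_of_supercompacts_is_wsc (δ : ZFSet) (hW : Woodin δ)
    (hsc : ∀ α ∈ δ, ∃ κ : ZFSet, α ∈ κ ∧ κ ∈ δ ∧ LtSupercompact κ δ) :
    WoodinSC δ := by
  exact main_aux δ hW hsc

end WSC
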